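/- arXiv:2411.09321 — 4 statements merged into one kernel-verified Lean document; each statement's English description precedes it below -/
import Mathlib

section
/- Let η = 1/8000. There exists k₀ such that for all integers k ≥ k₀, the diagonal Ramsey number satisfies r(k) ≤ 2^{(2 - η²/10)k}. -/
/-- A coloring `c` of the complete graph on `Fin N` contains a monochromatic clique
on `k` vertices. -/
def HasMonoClique (N k : ℕ) (c : Fin N → Fin N → Bool) : Prop :=
  ∃ (S : Finset (Fin N)) (b : Bool), S.card = k ∧
    ∀ v ∈ S, ∀ w ∈ S, v ≠ w → c v w = b

/-- The diagonal Ramsey number `r(k)`: the least `N` such that every symmetric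
two-coloring of the edges of `K_N` contains a monochromatic `K_k`. -/
noncomputable def ramsey (k : ℕ) : ℕ :=
  sInf {N | ∀ c : Fin N → Fin N → Bool, (∀ v w, c v w = c w v) → HasMonoClique N k c}


open Finset in
lemma kernel_pow_nonneg {V ι : Type*} (X : Finset V) (Y : Finset ι) (τ : V → ι → ℝ) (n : ℕ) :
    ∀ w : V → ℝ, 0 ≤ ∑ u ∈ X, ∑ v ∈ X, w u * w v * (∑ b ∈ Y, τ u b * τ v b) ^ n := by
  induction n with
  | zero =>
    intro w
    have : ∑ u ∈ X, ∑ v ∈ X, w u * w v * (∑ b ∈ Y, τ u b * τ v b) ^ 0 = (∑ u ∈ X, w u) ^ 2 := by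
      simp only [pow_zero, mul_one]
      rw [sq, Finset.sum_mul_sum]
    rw [this]
    positivity
  | succ n ih =>
    intro w
    have : ∑ u ∈ X, ∑ v ∈ X, w u * w v * (∑ b ∈ Y, τ u b * τ v b) ^ (n + 1)
        = ∑ b ∈ Y, ∑ u ∈ X, ∑ v ∈ X,
            (w u * τ u b) * (w v * τ v b) * (∑ b ∈ Y, τ u b * τ v b) ^ n := by
      rw [Finset.sum_comm]
      conv_rhs => rw [Finset.sum_comm]
      rw [Finset.sum_comm]
      refine Finset.sum_congr rfl fun u _ => ?_
      conv_rhs => rw [Finset.sum_comm]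
      refine Finset.sum_congr rfl fun v _ => ?_
      rw [pow_succ, Finset.mul_sum, Finset.mul_sum]
      refine Finset.sum_congr rfl fun b _ => ?_
      ring
    rw [this]
    exact Finset.sum_nonneg fun b _ => ih _

/-- The function `2 + cosh (2 √x)`, continued analytically to negative `x`. -/
noncomputable def gfun (x : ℝ) : ℝ :=
  2 + if 0 ≤ x then Real.cosh (2 * √x) else Real.cos (2 * √(-x))

lemma gfun_hasSum (x : ℝ) :
    HasSum (fun n : ℕ => (4 * x) ^ n / ((2 * n).factorial : ℝ)) (gfun x - 2) := by
  unfold gfun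
  split_ifs with h
  · have := Real.hasSum_cosh (2 * √x)
    rw [add_sub_cancel_left]
    convert this using 2 with n
    rw [pow_mul (2 * √x), mul_pow _ _ 2, Real.sq_sqrt h]
    norm_num
  · have := Real.hasSum_cos (2 * √(-x))
    rw [add_sub_cancel_left]
    convert this using 2 with n
    rw [pow_mul (2 * √(-x)), mul_pow _ _ 2, Real.sq_sqrt (by linarith), ← mul_pow]
    congr 2
    ring

lemma gfun_neg_ge {x : ℝ} (h : x < 0) : 1 ≤ gfun x := by
  unfold gfun
  rw [if_neg (by linarith)]
  linarith [Real.neg_one_le_cos (2 * √(-x))]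

lemma gfun_neg_le {x : ℝ} (h : x < 0) : gfun x ≤ 3 := by
  unfold gfun
  rw [if_neg (by linarith)]
  linarith [Real.cos_le_one (2 * √(-x))]

lemma gfun_ge_quad {x : ℝ} (h : 0 ≤ x) : 3 + 2 * x + 2 / 3 * x ^ 2 ≤ gfun x := by
  have hs := gfun_hasSum x
  have := sum_le_hasSum (Finset.range 3) (fun n _ => by positivity) hs
  simp [Finset.sum_range_succ, Nat.factorial] at this
  nlinarith

lemma gfun_pos (x : ℝ) : 1 ≤ gfun x := by
  rcases lt_or_ge x 0 with h | h
  · exact gfun_neg_ge h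
  · nlinarith [gfun_ge_quad h, sq_nonneg x]

lemma gfun_le_exp {x l : ℝ} (h : x ≤ l) : gfun x ≤ 3 * Real.exp (2 * √l) := by
  have h1 : 1 ≤ Real.exp (2 * √l) := Real.one_le_exp (by positivity)
  rcases lt_or_ge x 0 with h0 | h0
  · linarith [gfun_neg_le h0]
  · unfold gfun
    rw [if_pos h0]
    have : Real.cosh (2 * √x) ≤ Real.exp (2 * √x) := by
      rw [← Real.cosh_add_sinh]
      linarith [Real.sinh_nonneg_iff.2 (show 0 ≤ 2 * √x by positivity)]
    have h2 : Real.exp (2 * √x) ≤ Real.exp (2 * √l) := by gcongr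
    linarith

/-- The bound for the test function. -/
noncomputable def Fb (l : ℝ) : ℝ := 6 * l * Real.exp (2 * √l)

noncomputable def bn (n : ℕ) : ℝ := 1 / (2 * Fb (n + 1) * (n * (n + 1)))

lemma testfun_bad {x y : ℝ} (h : x < -1) : x * gfun y + y * gfun x ≤ -1 := by
  have hx := gfun_neg_ge (show x < 0 by linarith)
  have hx' := gfun_neg_le (show x < 0 by linarith)
  have hy := gfun_pos y
  rcases lt_or_ge y 0 with h0 | h0
  · nlinarith
  · have := gfun_ge_quad h0
    nlinarith [sq_nonneg (y - 1)]

lemma testfun_aux {x y l : ℝ} (hl : 0 ≤ l) (hx : x ≤ l) (hy : y ≤ l) :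
    x * gfun y ≤ l * (3 * Real.exp (2 * √l)) := by
  have h1 := gfun_pos y
  have h2 := gfun_le_exp hy
  calc x * gfun y ≤ l * gfun y := by gcongr
    _ ≤ _ := by gcongr

lemma testfun_good {x y l : ℝ} (hl : 0 ≤ l) (hx : x ≤ l) (hy : y ≤ l) :
    x * gfun y + y * gfun x ≤ Fb l := by
  have := testfun_aux hl hx hy
  have := testfun_aux hl hy hx
  unfold Fb
  linarith

lemma kernel_gfun_nonneg {V ι κ : Type*} (X : Finset V) (Y : Finset ι) (Z : Finset κ)
    (τ : V → ι → ℝ) (ρ : V → κ → ℝ) (r s : ℝ) (hr : 0 ≤ r) (hs : 0 ≤ s) :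
    0 ≤ ∑ u ∈ X, ∑ v ∈ X, (r * ∑ b ∈ Y, τ u b * τ v b) *
      gfun (s * ∑ b ∈ Z, ρ u b * ρ v b) := by
  have key : ∀ n : ℕ, 0 ≤ ∑ u ∈ X, ∑ v ∈ X, (r * ∑ b ∈ Y, τ u b * τ v b) *
      (∑ b ∈ Z, ρ u b * ρ v b) ^ n := by
    intro n
    have : ∑ u ∈ X, ∑ v ∈ X, (r * ∑ b ∈ Y, τ u b * τ v b) * (∑ b ∈ Z, ρ u b * ρ v b) ^ n
      = r * ∑ b ∈ Y, ∑ u ∈ X, ∑ v ∈ X, τ u b * τ v b * (∑ b ∈ Z, ρ u b * ρ v b) ^ n := by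
      rw [Finset.sum_comm (s := Y), Finset.mul_sum]
      refine Finset.sum_congr rfl fun u _ => ?_
      rw [Finset.sum_comm (s := Y), Finset.mul_sum]
      refine Finset.sum_congr rfl fun v _ => ?_
      rw [← Finset.sum_mul]
      ring
    rw [this]
    exact mul_nonneg hr (Finset.sum_nonneg fun b _ => kernel_pow_nonneg X Z ρ n _)
  have h1 : HasSum (fun n : ℕ => ∑ u ∈ X, ∑ v ∈ X, (r * ∑ b ∈ Y, τ u b * τ v b) *
      ((4 * (s * ∑ b ∈ Z, ρ u b * ρ v b)) ^ n / ((2 * n).factorial : ℝ)))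
      (∑ u ∈ X, ∑ v ∈ X, (r * ∑ b ∈ Y, τ u b * τ v b) *
        (gfun (s * ∑ b ∈ Z, ρ u b * ρ v b) - 2)) :=
    hasSum_sum fun u _ => hasSum_sum fun v _ => (gfun_hasSum _).mul_left _
  have h2 : 0 ≤ ∑ u ∈ X, ∑ v ∈ X, (r * ∑ b ∈ Y, τ u b * τ v b) *
        (gfun (s * ∑ b ∈ Z, ρ u b * ρ v b) - 2) := by
    refine h1.nonneg fun n => ?_
    have := mul_nonneg (show 0 ≤ (4 * s) ^ n / ((2 * n).factorial : ℝ) by positivity) (key n)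
    refine this.trans_eq ?_
    rw [Finset.mul_sum]
    refine Finset.sum_congr rfl fun u _ => ?_
    rw [Finset.mul_sum]
    refine Finset.sum_congr rfl fun v _ => ?_
    rw [← mul_assoc 4 s, mul_pow (4 * s)]
    ring
  have h3 := key 0
  have : ∑ u ∈ X, ∑ v ∈ X, (r * ∑ b ∈ Y, τ u b * τ v b) * gfun (s * ∑ b ∈ Z, ρ u b * ρ v b)
    = ∑ u ∈ X, ∑ v ∈ X, (r * ∑ b ∈ Y, τ u b * τ v b) *
        (gfun (s * ∑ b ∈ Z, ρ u b * ρ v b) - 2) + 2 * ∑ u ∈ X, ∑ v ∈ X,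
        (r * ∑ b ∈ Y, τ u b * τ v b) * (∑ b ∈ Z, ρ u b * ρ v b) ^ 0 := by
    rw [Finset.mul_sum, ← Finset.sum_add_distrib]
    refine Finset.sum_congr rfl fun u _ => ?_
    rw [Finset.mul_sum, ← Finset.sum_add_distrib]
    refine Finset.sum_congr rfl fun v _ => ?_
    ring
  rw [this]
  linarith

lemma Fb_pos {l : ℝ} (h : 0 < l) : 0 < Fb l := by unfold Fb; positivity

lemma bn_pos {n : ℕ} (h : 0 < n) : 0 < bn n := by
  unfold bn
  have : 0 < Fb ((n : ℝ) + 1) := Fb_pos (by positivity)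
  positivity

lemma tele (n0 N : ℕ) (h0 : 0 < n0) (h : n0 ≤ N) :
    ∑ n ∈ Finset.Ico n0 N, (1 : ℝ) / (n * (n + 1)) = 1 / n0 - 1 / N := by
  induction N, h using Nat.le_induction with
  | base => simp
  | succ n hn ih =>
    rw [Finset.sum_Ico_succ_top hn, ih]
    have : (0 : ℝ) < n := by exact_mod_cast (by omega : 0 < n)
    push_cast
    field_simp
    ring

open Classical in
lemma pair_lemma {V : Type*} (X : Finset V) (hX : X.Nonempty) (K : Bool → V → V → ℝ)
    (n0 : ℕ) (hn0 : 4 ≤ n0)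
    (hpos : ∀ b, 0 ≤ ∑ u ∈ X, ∑ v ∈ X, K b u v * gfun (K (!b) u v)) :
    (∃ u ∈ X, (X.card : ℝ) / (4 * Fb n0) ≤ (X.filter fun v => ∀ b, -1 ≤ K b u v).card) ∨
    (∃ n : ℕ, n0 ≤ n ∧ ∃ b, ∃ u ∈ X, bn n * X.card ≤
      (X.filter fun v => (∀ b, -1 ≤ K b u v) ∧ n ≤ K b u v).card) := by
  by_contra hcon
  push Not at hcon
  obtain ⟨hg, hb⟩ := hcon
  -- upper bound for the kernel
  obtain ⟨N, hN0, hN⟩ : ∃ N : ℕ, n0 ≤ N ∧ ∀ b, ∀ u ∈ X, ∀ v ∈ X, K b u v < N := by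
    refine ⟨n0 + ((Finset.univ : Finset Bool) ×ˢ (X ×ˢ X)).sup
      (fun z => ⌊|K z.1 z.2.1 z.2.2|⌋₊ + 1), by omega, fun b u hu v hv => ?_⟩
    have h1 : ⌊|K b u v|⌋₊ + 1 ≤ ((Finset.univ : Finset Bool) ×ˢ (X ×ˢ X)).sup
      (fun z => ⌊|K z.1 z.2.1 z.2.2|⌋₊ + 1) :=
      Finset.le_sup (f := fun z : Bool × V × V => ⌊|K z.1 z.2.1 z.2.2|⌋₊ + 1)
        (b := (b, u, v)) (by simp [hu, hv])
    have h2 := Nat.lt_floor_add_one |K b u v|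
    have h3 : ((⌊|K b u v|⌋₊ + 1 : ℕ) : ℝ) ≤ _ := Nat.cast_le.2 h1
    push_cast at h3 ⊢
    have : (0 : ℝ) ≤ n0 := by positivity
    linarith [le_abs_self (K b u v)]
  have hn0' : (4 : ℝ) ≤ n0 := by exact_mod_cast hn0
  have hF0 : 6 ≤ Fb n0 := by
    unfold Fb
    have : 1 ≤ Real.exp (2 * √(n0 : ℝ)) := Real.one_le_exp (by positivity)
    nlinarith
  have hFn : ∀ n : ℕ, 0 < Fb ((n : ℝ) + 1) := fun n => Fb_pos (by positivity)
  have hpt : ∀ u ∈ X, ∀ v ∈ X,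
      K true u v * gfun (K false u v) + K false u v * gfun (K true u v) ≤
      -1 + (Fb n0 + 1) * (if ∀ b, -1 ≤ K b u v then 1 else 0)
        + ∑ n ∈ Finset.Ico n0 N, ∑ b : Bool, Fb ((n : ℝ) + 1) *
          (if (∀ b, -1 ≤ K b u v) ∧ (n : ℝ) ≤ K b u v then 1 else 0) := by
    intro u hu v hv
    have hterm : ∀ n : ℕ, ∀ b : Bool, 0 ≤ Fb ((n : ℝ) + 1) *
          (if (∀ b, -1 ≤ K b u v) ∧ (n : ℝ) ≤ K b u v then (1 : ℝ) else 0) := by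
      intro n b
      have := hFn n
      split_ifs <;> simp [this.le]
    have hsum : 0 ≤ ∑ n ∈ Finset.Ico n0 N, ∑ b : Bool, Fb ((n : ℝ) + 1) *
          (if (∀ b, -1 ≤ K b u v) ∧ (n : ℝ) ≤ K b u v then (1 : ℝ) else 0) :=
      Finset.sum_nonneg fun n _ => Finset.sum_nonneg fun b _ => hterm n b
    by_cases hgood : ∀ b, -1 ≤ K b u v
    · rw [if_pos hgood]
      by_cases hM : ∀ b, K b u v ≤ n0
      · have := testfun_good (by linarith) (hM true) (hM false)
        linarith
      · -- the maximal kernel value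
        obtain ⟨b, hb1, hb2⟩ : ∃ b, (n0 : ℝ) ≤ K b u v ∧ ∀ b', K b' u v ≤ K b u v := by
          push Not at hM
          obtain ⟨b, hb⟩ := hM
          rcases le_total (K true u v) (K false u v) with h | h
          · refine ⟨false, ?_, ?_⟩
            · cases b <;> linarith
            · intro b'; cases b' <;> linarith
          · refine ⟨true, ?_, ?_⟩
            · cases b <;> linarith
            · intro b'; cases b' <;> linarith
        have hK0 : 0 ≤ K b u v := by linarith
        have hfl : (⌊K b u v⌋₊ : ℝ) ≤ K b u v := Nat.floor_le hK0
        have hfl2 := Nat.lt_floor_add_one (K b u v)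
        have hmem : ⌊K b u v⌋₊ ∈ Finset.Ico n0 N := by
          rw [Finset.mem_Ico]
          refine ⟨Nat.le_floor hb1, (Nat.floor_lt hK0).2 (hN b u hu v hv)⟩
        have h1 := Finset.single_le_sum (s := Finset.Ico n0 N)
          (f := fun n : ℕ => ∑ b : Bool, Fb ((n : ℝ) + 1) *
          (if (∀ b, -1 ≤ K b u v) ∧ (n : ℝ) ≤ K b u v then (1 : ℝ) else 0))
          (fun n _ => Finset.sum_nonneg fun b _ => hterm n b) hmem
        have h2 := Finset.single_le_sum (s := (Finset.univ : Finset Bool))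
          (f := fun b' : Bool => Fb ((⌊K b u v⌋₊ : ℝ) + 1) *
          (if (∀ b, -1 ≤ K b u v) ∧ (⌊K b u v⌋₊ : ℝ) ≤ K b' u v then (1 : ℝ) else 0))
          (fun b' _ => hterm _ b') (Finset.mem_univ b)
        simp only [hgood, hfl, and_self, if_true, implies_true, true_and] at h1 h2 ⊢
        have h3 := testfun_good (x := K true u v) (y := K false u v)
          (l := (⌊K b u v⌋₊ : ℝ) + 1) (by positivity) ((hb2 _).trans hfl2.le)
          ((hb2 _).trans hfl2.le)
        linarith
    · rw [if_neg hgood]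
      push Not at hgood
      obtain ⟨b, hb⟩ := hgood
      have : K true u v * gfun (K false u v) + K false u v * gfun (K true u v) ≤ -1 := by
        cases b
        · linarith [testfun_bad (y := K true u v) hb]
        · linarith [testfun_bad (y := K false u v) hb]
      linarith
  have hXc : (0 : ℝ) < X.card := by exact_mod_cast hX.card_pos
  have hu : ∀ u ∈ X, ∑ v ∈ X,
      (K true u v * gfun (K false u v) + K false u v * gfun (K true u v)) < 0 := by
    intro u hu
    have h1 := Finset.sum_le_sum (hpt u hu)
    refine h1.trans_lt ?_
    rw [Finset.sum_add_distrib, Finset.sum_add_distrib, ← Finset.mul_sum, Finset.sum_boole,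
      Finset.sum_comm]
    have h2 : ∑ n ∈ Finset.Ico n0 N, ∑ v ∈ X, ∑ b : Bool, Fb ((n : ℝ) + 1) *
          (if (∀ b, -1 ≤ K b u v) ∧ (n : ℝ) ≤ K b u v then (1 : ℝ) else 0)
        ≤ ∑ n ∈ Finset.Ico n0 N, X.card * (1 / (n * (n + 1) : ℝ)) := by
      refine Finset.sum_le_sum fun n hn => ?_
      rw [Finset.sum_comm]
      have hn' : n0 ≤ n := (Finset.mem_Ico.1 hn).1
      have hnp : (0 : ℝ) < n := by exact_mod_cast (by omega : 0 < n)
      have h3 : ∀ b : Bool, ∑ v ∈ X, Fb ((n : ℝ) + 1) *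
          (if (∀ b, -1 ≤ K b u v) ∧ (n : ℝ) ≤ K b u v then (1 : ℝ) else 0)
          ≤ Fb ((n : ℝ) + 1) * (bn n * X.card) := by
        intro b
        rw [← Finset.mul_sum, Finset.sum_boole]
        exact mul_le_mul_of_nonneg_left (hb n hn' b u hu).le (hFn n).le
      have h4 := Finset.sum_le_sum fun b (_ : b ∈ (Finset.univ : Finset Bool)) => h3 b
      refine h4.trans_eq ?_
      have := (hFn n).ne'
      simp only [Finset.sum_const, Finset.card_univ, Fintype.card_bool, bn, nsmul_eq_mul]
      push_cast
      field_simp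
    rw [← Finset.mul_sum, tele n0 N (by omega) hN0] at h2
    have h5 := hg u hu
    have h6 : (1 : ℝ) / n0 ≤ 1 / 4 := by gcongr
    have h7 : (0 : ℝ) ≤ 1 / N := by positivity
    have h8 : (X.card : ℝ) * (1 / n0 - 1 / N) ≤ X.card * (1 / 4) := by
      gcongr; linarith
    have h9 : (Fb n0 + 1) * ((X.filter fun v => ∀ b, -1 ≤ K b u v).card : ℝ)
        ≤ (Fb n0 + 1) * (X.card / (4 * Fb n0)) := by
      gcongr
    have h10 : (Fb n0 + 1) * (X.card / (4 * Fb n0)) ≤ X.card * (1 / 2) := by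
      rw [mul_div_assoc', div_le_iff₀ (by positivity)]
      nlinarith
    simp only [Finset.sum_const, nsmul_eq_mul]
    linarith
  have htot := Finset.sum_lt_sum_of_nonempty hX hu
  simp only [Finset.sum_add_distrib, Finset.sum_const_zero] at htot
  have e1 := hpos true
  have e2 := hpos false
  simp only [Bool.not_true, Bool.not_false] at e1 e2
  linarith
/-- Neighbourhood of `v` in colour `b`. -/
def nb {V : Type*} [Fintype V] [DecidableEq V] (c : V → V → Bool) (b : Bool) (v : V) : Finset V :=
  Finset.univ.filter fun w => w ≠ v ∧ c v w = b

lemma mem_nb {V : Type*} [Fintype V] [DecidableEq V] {c : V → V → Bool} {b : Bool} {v w : V} :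
    w ∈ nb c b v ↔ w ≠ v ∧ c v w = b := by
  simp [nb]

lemma kernel_expand {V : Type*} [DecidableEq V] (Y A B : Finset V) (hA : A ⊆ Y) (hB : B ⊆ Y)
    (p : ℝ) (hAc : (A.card : ℝ) = p * Y.card) (hBc : (B.card : ℝ) = p * Y.card) :
    ∑ y ∈ Y, ((if y ∈ A then (1 : ℝ) else 0) - p) * ((if y ∈ B then (1 : ℝ) else 0) - p)
      = (A ∩ B).card - p ^ 2 * Y.card := by
  have h1 : ∑ y ∈ Y, (if y ∈ A then (1 : ℝ) else 0) = p * Y.card := by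
    rw [← hAc, Finset.sum_boole, Finset.filter_mem_eq_inter, Finset.inter_eq_right.2 hA]
  have h2 : ∑ y ∈ Y, (if y ∈ B then (1 : ℝ) else 0) = p * Y.card := by
    rw [← hBc, Finset.sum_boole, Finset.filter_mem_eq_inter, Finset.inter_eq_right.2 hB]
  have h3 : ∑ y ∈ Y, (if y ∈ A ∩ B then (1 : ℝ) else 0) = (A ∩ B).card := by
    rw [Finset.sum_boole, Finset.filter_mem_eq_inter,
      Finset.inter_eq_right.2 (Finset.inter_subset_left.trans hA)]
  have : ∀ y ∈ Y, ((if y ∈ A then (1 : ℝ) else 0) - p) * ((if y ∈ B then (1 : ℝ) else 0) - p)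
      = (if y ∈ A ∩ B then (1 : ℝ) else 0) - p * (if y ∈ A then (1 : ℝ) else 0)
        - p * (if y ∈ B then (1 : ℝ) else 0) + p ^ 2 := by
    intro y _
    by_cases ha : y ∈ A <;> by_cases hb : y ∈ B <;> simp [ha, hb] <;> ring
  rw [Finset.sum_congr rfl this, Finset.sum_add_distrib, Finset.sum_sub_distrib,
    Finset.sum_sub_distrib, ← Finset.mul_sum, ← Finset.mul_sum, h1, h2, h3]
  simp
  ring

/-- One step of the algorithm. -/
lemma step_lemma {V : Type*} [Fintype V] [DecidableEq V] (c : V → V → Bool)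
    (X : Finset V) (hX : X.Nonempty) (Y : Bool → Finset V) (p α : Bool → ℝ)
    (hp : ∀ b, 0 < p b) (hα : ∀ b, 0 < α b) (hY : ∀ b, (Y b).Nonempty)
    (d : Bool → ℕ) (hd : ∀ b, (d b : ℝ) = p b * (Y b).card)
    (hdeg : ∀ b, ∀ x ∈ X, d b ≤ (nb c b x ∩ Y b).card) (n0 : ℕ) (hn0 : 4 ≤ n0) :
    (∃ u ∈ X, ∃ X' ⊆ X, (X.card : ℝ) / (4 * Fb n0) ≤ X'.card ∧ ∀ b, ∃ Y' ⊆ nb c b u ∩ Y b,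
      (Y'.card : ℝ) = p b * (Y b).card ∧
      ∀ v ∈ X', (p b - α b) * Y'.card ≤ (nb c b v ∩ Y').card) ∨
    (∃ n : ℕ, n0 ≤ n ∧ ∃ b, ∃ X' ⊆ X, bn n * X.card ≤ X'.card ∧ ∃ Y' ⊆ Y b,
      (Y'.card : ℝ) = p b * (Y b).card ∧
      ∀ v ∈ X', (p b + n * α b) * Y'.card ≤ (nb c b v ∩ Y').card) := by
  classical
  have hN : ∀ b x, ∃ A : Finset V, x ∈ X → A ⊆ nb c b x ∩ Y b ∧ A.card = d b := by
    intro b x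
    by_cases hx : x ∈ X
    · obtain ⟨A, hA, hA'⟩ := Finset.exists_subset_card_eq (hdeg b x hx)
      exact ⟨A, fun _ => ⟨hA, hA'⟩⟩
    · exact ⟨∅, fun h => absurd h hx⟩
  choose A hA using hN
  have hYc : ∀ b, (0 : ℝ) < (Y b).card := fun b => by exact_mod_cast (hY b).card_pos
  let s : Bool → ℝ := fun b => 1 / (α b * (p b * (Y b).card))
  have hs : ∀ b, 0 < s b := fun b => by
    have := hp b; have := hα b; have := hYc b
    positivity
  let K : Bool → V → V → ℝ := fun b u v => s b * ∑ y ∈ Y b,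
    ((if y ∈ A b u then (1 : ℝ) else 0) - p b) * ((if y ∈ A b v then (1 : ℝ) else 0) - p b)
  have hK : ∀ b, ∀ u ∈ X, ∀ v ∈ X, K b u v = s b * ((A b u ∩ A b v).card - p b ^ 2 * (Y b).card) := by
    intro b u hu v hv
    have h1 := hA b u hu
    have h2 := hA b v hv
    simp only [K]
    rw [kernel_expand (Y b) (A b u) (A b v) (h1.1.trans Finset.inter_subset_right)
      (h2.1.trans Finset.inter_subset_right) (p b) (by rw [h1.2, hd]) (by rw [h2.2, hd])]
  have hkey : ∀ b, ∀ u ∈ X, ∀ v ∈ X, ∀ l : ℝ, l ≤ K b u v →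
      (p b + l * α b) * (A b u).card ≤ (nb c b v ∩ A b u).card := by
    intro b u hu v hv l hl
    rw [hK b u hu v hv] at hl
    have h1 := hA b u hu
    have h2 := hA b v hv
    have h3 : ((A b u ∩ A b v).card : ℝ) ≤ (nb c b v ∩ A b u).card := by
      norm_cast
      refine Finset.card_le_card fun y hy => ?_
      rw [Finset.mem_inter] at hy ⊢
      exact ⟨(Finset.mem_inter.1 (h2.1 hy.2)).1, hy.1⟩
    refine le_trans ?_ h3
    rw [h1.2, hd]
    have := hp b; have := hα b; have := hYc b
    simp only [s] at hl
    rw [one_div_mul_eq_div, le_div_iff₀ (by positivity)] at hl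
    nlinarith
  rcases pair_lemma X hX K n0 hn0 (fun b => kernel_gfun_nonneg X (Y b) (Y (!b)) _ _ _ _
    (hs b).le (hs _).le) with ⟨u, hu, h⟩ | ⟨n, hn, b, u, hu, h⟩
  · left
    refine ⟨u, hu, _, Finset.filter_subset _ _, h, fun b => ⟨A b u, (hA b u hu).1, ?_, ?_⟩⟩
    · rw [(hA b u hu).2, hd]
    · intro v hv
      rw [Finset.mem_filter] at hv
      have := hkey b u hu v hv.1 (-1) (hv.2 b)
      linarith
  · right
    refine ⟨n, hn, b, _, Finset.filter_subset _ _, h, A b u,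
      (hA b u hu).1.trans Finset.inter_subset_right, ?_, ?_⟩
    · rw [(hA b u hu).2, hd]
    · intro v hv
      rw [Finset.mem_filter] at hv
      exact hkey b u hu v hv.1 n hv.2.2

/-- A monochromatic book. -/
def HasBook {V : Type*} (c : V → V → Bool) (X : Finset V) (Y : Bool → Finset V)
    (a : Bool → ℕ) (m : Bool → ℝ) : Prop :=
  ∃ b, ∃ S ⊆ X, ∃ M ⊆ Y b, S.card = a b ∧ m b ≤ M.card ∧
    (∀ v ∈ S, ∀ w ∈ S, v ≠ w → c v w = b) ∧ (∀ v ∈ S, ∀ w ∈ M, w ≠ v ∧ c v w = b)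

lemma exact_p {V : Type*} [Fintype V] [DecidableEq V] (c : V → V → Bool)
    (X Y : Finset V) (hX : X.Nonempty) (hY : Y.Nonempty) (b : Bool) (p : ℝ)
    (hdeg : ∀ x ∈ X, p * Y.card ≤ (nb c b x ∩ Y).card) :
    ∃ p' : ℝ, ∃ d : ℕ, p ≤ p' ∧ p' ≤ 1 ∧ (d : ℝ) = p' * Y.card ∧
      ∀ x ∈ X, d ≤ (nb c b x ∩ Y).card := by
  have hYc : (0 : ℝ) < Y.card := by exact_mod_cast hY.card_pos
  have hd : ∀ x ∈ X, ⌈p * Y.card⌉₊ ≤ (nb c b x ∩ Y).card := fun x hx => Nat.ceil_le.2 (hdeg x hx)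
  refine ⟨⌈p * Y.card⌉₊ / Y.card, ⌈p * Y.card⌉₊, ?_, ?_, ?_, hd⟩
  · rw [le_div_iff₀ hYc]
    exact Nat.le_ceil _
  · rw [div_le_one hYc]
    obtain ⟨x, hx⟩ := hX
    exact_mod_cast (hd x hx).trans (Finset.card_le_card Finset.inter_subset_right)
  · field_simp
lemma sum_bool_change (g g' : Bool → ℝ) (j : Bool) (h : ∀ b, b ≠ j → g' b = g b) :
    ∑ b, g' b = ∑ b, g b + (g' j - g j) := by
  cases j
  · simp [h true]
  · simp [h false]; ring

/-- potential -/
noncomputable def Hp (t : ℕ) (q p : ℝ) (a : ℕ) : ℝ := (p - q) * (1 - 1 / (t : ℝ)) ^ a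

lemma Hp_pos {t : ℕ} (ht : 2 ≤ t) {q p : ℝ} (h : q < p) (a : ℕ) : 0 < Hp t q p a := by
  unfold Hp
  have : (2 : ℝ) ≤ t := by exact_mod_cast ht
  have h1 : 0 < 1 - 1 / (t : ℝ) := by
    rw [sub_pos, div_lt_one (by linarith)]; linarith
  have := sub_pos.2 h
  positivity

lemma Hp_mono {t : ℕ} (ht : 2 ≤ t) {q p p' : ℝ} (h : p ≤ p') (a : ℕ) :
    Hp t q p a ≤ Hp t q p' a := by
  unfold Hp
  have : (2 : ℝ) ≤ t := by exact_mod_cast ht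
  have h1 : 0 < 1 - 1 / (t : ℝ) := by
    rw [sub_pos, div_lt_one (by linarith)]; linarith
  gcongr

lemma Hp_le {t : ℕ} (ht : 2 ≤ t) {q p : ℝ} (h : q ≤ p) (a : ℕ) :
    Hp t q p a ≤ p - q := by
  unfold Hp
  have : (2 : ℝ) ≤ t := by exact_mod_cast ht
  have h1 : 0 < 1 - 1 / (t : ℝ) := by
    rw [sub_pos, div_lt_one (by linarith)]; linarith
  have h2 : (1 - 1 / (t : ℝ)) ^ a ≤ 1 := pow_le_one₀ h1.le (by
    have : 0 < 1 / (t : ℝ) := by positivity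
    linarith)
  have := sub_nonneg.2 h
  nlinarith

lemma book_induction {V : Type*} [Fintype V] [DecidableEq V] (c : V → V → Bool)
    (hc : ∀ v w, c v w = c w v)
    (t n0 : ℕ) (ht : 2 ≤ t) (hn0 : 4 ≤ n0) (q c0 A κ θ : ℝ) (hq : 0 < q) (hc0 : 0 < c0)
    (hκ0 : 0 ≤ κ) (hθ0 : 0 ≤ θ) (m : Bool → ℝ) (hm : ∀ b, 0 < m b)
    (hA : 16 * Fb n0 ≤ Real.exp A)
    (hκ : ∀ n : ℕ, n0 ≤ n → (n : ℝ) * c0 ≤ t →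
      1 ≤ bn n * Real.exp (κ * Real.log (1 + n / t)))
    (hθ : 1 ≤ q * Real.exp (θ * Real.log (1 + n0 / t))) (N : ℕ) :
    ∀ (X : Finset V) (Y : Bool → Finset V) (p : Bool → ℝ) (a : Bool → ℕ),
      (∑ b, (a b + (Y b).card) ≤ N) →
      (∀ b, ∀ x ∈ X, p b * (Y b).card ≤ (nb c b x ∩ Y b).card) →
      (∀ b, q < p b) → (∀ b, c0 ≤ Hp t q (p b) (a b)) →
      Real.exp (∑ b, (A * a b + κ * (-Real.log (Hp t q (p b) (a b))))) ≤ X.card →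
      (∀ b, m b * Real.exp (a b * (-Real.log q) + θ * (-Real.log (Hp t q (p b) (a b))))
        ≤ (Y b).card) →
      HasBook c X Y a m := by
  induction N with
  | zero =>
    intro X Y p a hN hdeg hqp hH hX hY
    exfalso
    have h1 := hY true
    have h2 := mul_pos (hm true) (Real.exp_pos ((a true : ℝ) * (-Real.log q) +
      θ * (-Real.log (Hp t q (p true) (a true)))))
    have h3 : (0 : ℝ) < (Y true).card := by linarith
    have h4 : 0 < (Y true).card := by exact_mod_cast h3
    simp at hN
    simp [hN] at h4
  | succ N ih =>
    intro X Y p₀ a hN hdeg hqp₀ hH₀ hX₀ hY₀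
    have htr : (2 : ℝ) ≤ t := by exact_mod_cast ht
    have hXc : (0 : ℝ) < X.card := (Real.exp_pos _).trans_le hX₀
    have hXn : X.Nonempty := Finset.card_pos.1 (by exact_mod_cast hXc)
    have hYc : ∀ b, (0 : ℝ) < (Y b).card := fun b =>
      (mul_pos (hm b) (Real.exp_pos _)).trans_le (hY₀ b)
    have hYn : ∀ b, (Y b).Nonempty := fun b => Finset.card_pos.1 (by exact_mod_cast hYc b)
    choose p d hpp hp1 hd hdd using fun b => exact_p c X (Y b) hXn (hYn b) b (p₀ b) (hdeg b)
    have hqp : ∀ b, q < p b := fun b => (hqp₀ b).trans_le (hpp b)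
    have hHpos : ∀ b, 0 < Hp t q (p b) (a b) := fun b => Hp_pos ht (hqp b) _
    have hHm : ∀ b, Hp t q (p₀ b) (a b) ≤ Hp t q (p b) (a b) := fun b => Hp_mono ht (hpp b) _
    have hH : ∀ b, c0 ≤ Hp t q (p b) (a b) := fun b => (hH₀ b).trans (hHm b)
    have hlog : ∀ b, Real.log (Hp t q (p₀ b) (a b)) ≤ Real.log (Hp t q (p b) (a b)) :=
      fun b => Real.log_le_log (Hp_pos ht (hqp₀ b) _) (hHm b)
    have hX : Real.exp (∑ b, (A * a b + κ * (-Real.log (Hp t q (p b) (a b))))) ≤ X.card := by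
      refine le_trans (Real.exp_le_exp.2 (Finset.sum_le_sum fun b _ => ?_)) hX₀
      have := hlog b
      gcongr
    have hY : ∀ b, m b * Real.exp (a b * (-Real.log q) +
        θ * (-Real.log (Hp t q (p b) (a b)))) ≤ (Y b).card := by
      intro b
      refine le_trans ?_ (hY₀ b)
      have := hlog b
      have := hm b
      gcongr
    clear hX₀ hY₀ hlog hHm
    have hp0 : ∀ b, 0 < p b := fun b => hq.trans (hqp b)
    have hHle1 : ∀ b, Hp t q (p b) (a b) ≤ 1 := fun b => by
      have := Hp_le ht (hqp b).le (a b)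
      have := hp1 b
      linarith
    -- base case
    by_cases hbase : ∃ b, a b = 0
    · obtain ⟨b, hb⟩ := hbase
      refine ⟨b, ∅, by simp, Y b, subset_rfl, by simp [hb], ?_, by simp, by simp⟩
      refine le_trans ?_ (hY b)
      rw [hb]
      have h1 : 0 ≤ θ * (-Real.log (Hp t q (p b) 0)) := by
        have := Real.log_nonpos (hHpos b).le (hHle1 b)
        rw [hb] at this
        exact mul_nonneg hθ0 (by linarith)
      have h2 : 1 ≤ Real.exp (((0 : ℕ) : ℝ) * (-Real.log q) +
        θ * (-Real.log (Hp t q (p b) 0))) := Real.one_le_exp (by simpa using h1)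
      have := hm b
      nlinarith
    push Not at hbase
    have ha1 : ∀ b, 1 ≤ a b := fun b => Nat.one_le_iff_ne_zero.2 (hbase b)
    have hF0 : 6 ≤ Fb n0 := by
      have hn0' : (4 : ℝ) ≤ n0 := by exact_mod_cast hn0
      unfold Fb
      have : 1 ≤ Real.exp (2 * √(n0 : ℝ)) := Real.one_le_exp (by positivity)
      nlinarith
    have hA0 : 0 ≤ A := by
      by_contra h
      push Not at h
      have := Real.exp_le_one_iff.2 h.le
      linarith
    let α : Bool → ℝ := fun b => (p b - q) / t
    have hα : ∀ b, 0 < α b := fun b => by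
      have := sub_pos.2 (hqp b)
      positivity
    rcases step_lemma c X hXn Y p α hp0 hα hYn d hd hdd n0 hn0 with
      ⟨u, hu, X', hX'X, hX'c, hYs⟩ | ⟨n, hn, j, X', hX'X, hX'c, Y', hY'Y, hY'c, hY'deg⟩
    · -- colour step
      have hXbig : 16 * Fb n0 ≤ X.card := by
        refine hA.trans (le_trans (Real.exp_le_exp.2 ?_) hX)
        have h1 : ∀ b, 0 ≤ κ * (-Real.log (Hp t q (p b) (a b))) := fun b => by
          have := Real.log_nonpos (hHpos b).le (hHle1 b)
          exact mul_nonneg hκ0 (by linarith)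
        have h2 : ∀ b, (1 : ℝ) ≤ a b := fun b => by exact_mod_cast ha1 b
        rw [Fintype.sum_bool]
        nlinarith [h1 true, h1 false, h2 true, h2 false]
      have hX'2 : (2 : ℝ) ≤ X'.card := by
        refine le_trans ?_ hX'c
        rw [le_div_iff₀ (by positivity)]
        linarith
      obtain ⟨j, hj⟩ : ∃ j, (X'.card : ℝ) / 4 ≤ (X' ∩ nb c j u).card := by
        by_contra h
        push Not at h
        have h1 : X' ⊆ insert u ((X' ∩ nb c true u) ∪ (X' ∩ nb c false u)) := by
          intro v hv
          by_cases hvu : v = u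
          · simp [hvu]
          · cases hcv : c u v <;> simp [mem_nb, hv, hvu, hcv]
        have h2 := (Finset.card_le_card h1).trans (Finset.card_insert_le _ _)
        have h3 := Finset.card_union_le (X' ∩ nb c true u) (X' ∩ nb c false u)
        have h4 : (X'.card : ℝ) ≤ (X' ∩ nb c true u).card + (X' ∩ nb c false u).card + 1 := by
          exact_mod_cast h2.trans (by omega)
        linarith [h true, h false]
      obtain ⟨Y', hY'Y, hY'c, hY'deg⟩ := hYs j
      have hHj : Hp t q (p j - α j) (a j - 1) = Hp t q (p j) (a j) := by
        obtain ⟨e, he⟩ : ∃ e, a j = e + 1 := ⟨a j - 1, by have := ha1 j; omega⟩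
        rw [he]
        simp only [Hp, α, Nat.add_sub_cancel, pow_succ]
        ring
      have hcast : ((a j - 1 : ℕ) : ℝ) = a j - 1 := by
        rw [Nat.cast_sub (ha1 j)]; simp
      have key := ih (X' ∩ nb c j u) (Function.update Y j Y') (Function.update p j (p j - α j))
        (Function.update a j (a j - 1)) ?_ ?_ ?_ ?_ ?_ ?_
      · obtain ⟨b, S, hS, M, hM, hSc, hMc, hcl, hb⟩ := key
        by_cases hbj : b = j
        · subst hbj
          rw [Function.update_self] at hSc hM
          have huS : u ∉ S := fun h => by
            have := (Finset.mem_inter.1 (hS h)).2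
            rw [mem_nb] at this
            exact this.1 rfl
          have hSu : ∀ v ∈ S, c u v = b := fun v hv => by
            have := (Finset.mem_inter.1 (hS hv)).2
            rw [mem_nb] at this
            exact this.2
          refine ⟨b, insert u S, ?_, M, hM.trans (hY'Y.trans Finset.inter_subset_right), ?_,
            hMc, ?_, ?_⟩
          · intro v hv
            rcases Finset.mem_insert.1 hv with rfl | hv
            · exact hu
            · exact hX'X (Finset.mem_inter.1 (hS hv)).1
          · rw [Finset.card_insert_of_notMem huS, hSc]
            have := ha1 b
            omega
          · intro v hv w hw hvw
            rcases Finset.mem_insert.1 hv with hv' | hv' <;>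
            rcases Finset.mem_insert.1 hw with hw' | hw'
            · exact absurd (hv'.trans hw'.symm) hvw
            · rw [hv']; exact hSu w hw'
            · rw [hc, hw']; exact hSu v hv'
            · exact hcl v hv' w hw' hvw
          · intro v hv w hw
            rcases Finset.mem_insert.1 hv with rfl | hv
            · exact mem_nb.1 (Finset.mem_inter.1 (hY'Y (hM hw))).1
            · exact hb v hv w hw
        · rw [Function.update_of_ne hbj] at hSc hM
          exact ⟨b, S, hS.trans (Finset.inter_subset_left.trans hX'X), M, hM, hSc, hMc, hcl, hb⟩
      · -- measure
        have h1 : Y'.card ≤ (Y j).card :=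
          Finset.card_le_card (hY'Y.trans Finset.inter_subset_right)
        have h2 := ha1 j
        rw [Fintype.sum_bool] at hN ⊢
        cases j <;> simp at hN h1 h2 ⊢ <;> omega
      · intro b x hx
        have hx' := (Finset.mem_inter.1 hx).1
        by_cases hbj : b = j
        · subst hbj
          simp only [Function.update_self]
          exact hY'deg x hx'
        · simp only [Function.update_of_ne hbj]
          rw [← hd b]
          exact_mod_cast hdd b x (hX'X hx')
      · intro b
        by_cases hbj : b = j
        · subst hbj
          rw [Function.update_self]
          simp only [α]
          have h1 := sub_pos.2 (hqp b)
          have h2 : (p b - q) / t < p b - q := by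
            rw [div_lt_iff₀ (by linarith)]
            nlinarith
          linarith
        · rw [Function.update_of_ne hbj]
          exact hqp b
      · intro b
        by_cases hbj : b = j
        · subst hbj
          simp only [Function.update_self]
          rw [hHj]
          exact hH b
        · simp only [Function.update_of_ne hbj]
          exact hH b
      · rw [sum_bool_change (fun b => A * (a b : ℝ) + κ * (-Real.log (Hp t q (p b) (a b)))) _ j
          (fun b hb => by simp only [Function.update_of_ne hb])]
        simp only [Function.update_self]
        rw [hHj, hcast, Real.exp_add]
        have h1 : A * ((a j : ℝ) - 1) + κ * (-Real.log (Hp t q (p j) (a j))) -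
          (A * a j + κ * (-Real.log (Hp t q (p j) (a j)))) = -A := by ring
        rw [h1, Real.exp_neg]
        refine le_trans ?_ hj
        have h2 : (X.card : ℝ) * (Real.exp A)⁻¹ ≤ X.card / (4 * Fb n0) / 4 := by
          rw [div_div, ← div_eq_mul_inv]
          gcongr
          linarith
        calc _ ≤ (X.card : ℝ) * (Real.exp A)⁻¹ := by gcongr
          _ ≤ X.card / (4 * Fb n0) / 4 := h2
          _ ≤ _ := by gcongr
      · intro b
        by_cases hbj : b = j
        · subst hbj
          simp only [Function.update_self]
          rw [hHj, hY'c, hcast]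
          have h1 : ((a b : ℝ) - 1) * (-Real.log q) + θ * (-Real.log (Hp t q (p b) (a b)))
            = Real.log q + (a b * (-Real.log q) + θ * (-Real.log (Hp t q (p b) (a b)))) := by ring
          rw [h1, Real.exp_add, Real.exp_log hq]
          have h2 := mul_le_mul (hqp b).le (hY b)
            (mul_pos (hm b) (Real.exp_pos _)).le (hp0 b).le
          linarith
        · simp only [Function.update_of_ne hbj]
          exact hY b
    · -- density boost step
      have hbn := bn_pos (show 0 < n by omega)
      have hX'pos : (0 : ℝ) < X'.card := lt_of_lt_of_le (by positivity) hX'c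
      have hX'n : X'.Nonempty := Finset.card_pos.1 (by exact_mod_cast hX'pos)
      have hY'pos : (0 : ℝ) < Y'.card := by
        rw [hY'c]; exact mul_pos (hp0 j) (hYc j)
      have hnpos : (0 : ℝ) < n := by exact_mod_cast (by omega : 0 < n)
      have hp'1 : p j + n * α j ≤ 1 := by
        obtain ⟨v, hv⟩ := hX'n
        have h1 := hY'deg v hv
        have h2 : ((nb c j v ∩ Y').card : ℝ) ≤ Y'.card := by
          exact_mod_cast Finset.card_le_card Finset.inter_subset_right
        nlinarith
      have hHj : Hp t q (p j + n * α j) (a j) = Hp t q (p j) (a j) * (1 + n / t) := by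
        simp only [Hp, α]
        field_simp
        ring
      have hnt : (0 : ℝ) < 1 + n / t := by positivity
      have hlogj : Real.log (Hp t q (p j + n * α j) (a j)) =
          Real.log (Hp t q (p j) (a j)) + Real.log (1 + n / t) := by
        rw [hHj, Real.log_mul (hHpos j).ne' hnt.ne']
      have hpgt : p j < p j + n * α j := by
        have := hα j
        have : 0 < n * α j := by positivity
        linarith
      have hnc : (n : ℝ) * c0 ≤ t := by
        have h1 := (hH j).trans (Hp_le ht (hqp j).le (a j))
        have h2 : n * α j ≤ 1 := by linarith [hp0 j]
        simp only [α] at h2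
        rw [mul_div_assoc', div_le_one (by linarith)] at h2
        nlinarith
      have key := ih X' (Function.update Y j Y') (Function.update p j (p j + n * α j)) a
        ?_ ?_ ?_ ?_ ?_ ?_
      · obtain ⟨b, S, hS, M, hM, hSc, hMc, hcl, hb⟩ := key
        refine ⟨b, S, hS.trans hX'X, M, ?_, hSc, hMc, hcl, hb⟩
        by_cases hbj : b = j
        · subst hbj
          rw [Function.update_self] at hM
          exact hM.trans hY'Y
        · rwa [Function.update_of_ne hbj] at hM
      · have h1 : Y'.card < (Y j).card := by
          have : (Y'.card : ℝ) < (Y j).card := by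
            rw [hY'c]
            have := hYc j
            nlinarith
          exact_mod_cast this
        rw [Fintype.sum_bool] at hN ⊢
        cases j <;> simp at hN h1 ⊢ <;> omega
      · intro b x hx
        by_cases hbj : b = j
        · subst hbj
          simp only [Function.update_self]
          exact hY'deg x hx
        · simp only [Function.update_of_ne hbj]
          rw [← hd b]
          exact_mod_cast hdd b x (hX'X hx)
      · intro b
        by_cases hbj : b = j
        · subst hbj
          rw [Function.update_self]
          linarith [hqp b]
        · rw [Function.update_of_ne hbj]
          exact hqp b
      · intro b
        by_cases hbj : b = j
        · subst hbj
          simp only [Function.update_self]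
          exact (hH b).trans (Hp_mono ht hpgt.le _)
        · simp only [Function.update_of_ne hbj]
          exact hH b
      · rw [sum_bool_change (fun b => A * (a b : ℝ) + κ * (-Real.log (Hp t q (p b) (a b)))) _ j
          (fun b hb => by simp only [Function.update_of_ne hb])]
        simp only [Function.update_self]
        rw [hlogj, Real.exp_add]
        have h1 : A * (a j : ℝ) + κ * (-(Real.log (Hp t q (p j) (a j)) + Real.log (1 + n / t))) -
          (A * a j + κ * (-Real.log (Hp t q (p j) (a j)))) = -(κ * Real.log (1 + n / t)) := by ring
        rw [h1, Real.exp_neg]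
        refine le_trans ?_ hX'c
        have h3 := hκ n hn hnc
        have h2 : (Real.exp (κ * Real.log (1 + n / t)))⁻¹ ≤ bn n := by
          rw [inv_le_iff_one_le_mul₀ (Real.exp_pos _)]
          exact h3
        rw [mul_comm]
        exact mul_le_mul h2 hX (Real.exp_pos _).le hbn.le
      · intro b
        by_cases hbj : b = j
        · subst hbj
          simp only [Function.update_self]
          rw [hlogj, hY'c]
          have h1 : (a b : ℝ) * (-Real.log q) +
              θ * (-(Real.log (Hp t q (p b) (a b)) + Real.log (1 + n / t)))
            = -(θ * Real.log (1 + n / t)) +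
              (a b * (-Real.log q) + θ * (-Real.log (Hp t q (p b) (a b)))) := by ring
          rw [h1, Real.exp_add, Real.exp_neg]
          have h2 : (Real.exp (θ * Real.log (1 + n / t)))⁻¹ ≤ p b := by
            rw [inv_le_iff_one_le_mul₀ (Real.exp_pos _)]
            refine hθ.trans ?_
            have := hp0 b
            have := (hqp b).le
            gcongr
          have h3 := mul_le_mul h2 (hY b) (mul_pos (hm b) (Real.exp_pos _)).le (hp0 b).le
          linarith
        · simp only [Function.update_of_ne hbj]
          exact hY b
/-- `W` contains a clique of colour `b` and size `a b` for some `b`. -/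
def HasCl {V : Type*} (c : V → V → Bool) (W : Finset V) (a : Bool → ℕ) : Prop :=
  ∃ b, ∃ S ⊆ W, S.card = a b ∧ ∀ v ∈ S, ∀ w ∈ S, v ≠ w → c v w = b

lemma HasCl.extend {V : Type*} [DecidableEq V] {c : V → V → Bool}
    (hc : ∀ v w, c v w = c w v) {W M S : Finset V} {a : Bool → ℕ} {j : Bool} {t : ℕ}
    (hMW : M ⊆ W) (hSW : S ⊆ W) (hSt : S.card = t) (hta : t ≤ a j)
    (hS : ∀ v ∈ S, ∀ w ∈ S, v ≠ w → c v w = j) (hSM : ∀ v ∈ S, ∀ w ∈ M, w ≠ v ∧ c v w = j)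
    (h : HasCl c M (Function.update a j (a j - t))) : HasCl c W a := by
  obtain ⟨b, T, hT, hTc, hTm⟩ := h
  by_cases hbj : b = j
  · subst hbj
    rw [Function.update_self] at hTc
    refine ⟨b, S ∪ T, Finset.union_subset hSW (hT.trans hMW), ?_, ?_⟩
    · rw [Finset.card_union_of_disjoint, hSt, hTc]
      · omega
      · rw [Finset.disjoint_left]
        intro v hv hv'
        exact (hSM v hv v (hT hv')).1 rfl
    · intro v hv w hw hvw
      rcases Finset.mem_union.1 hv with hv' | hv' <;>
      rcases Finset.mem_union.1 hw with hw' | hw'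
      · exact hS v hv' w hw' hvw
      · exact (hSM v hv' w (hT hw')).2
      · rw [hc]; exact (hSM w hw' v (hT hv')).2
      · exact hTm v hv' w hw' hvw
  · rw [Function.update_of_ne hbj] at hTc
    exact ⟨b, T, hT.trans hMW, hTc, hTm⟩

lemma HasCl.step {V : Type*} [Fintype V] [DecidableEq V] {c : V → V → Bool}
    (hc : ∀ v w, c v w = c w v) {W : Finset V} {a : Bool → ℕ} {j : Bool} {u : V} (hu : u ∈ W)
    (ha : 1 ≤ a j) (h : HasCl c (nb c j u ∩ W) (Function.update a j (a j - 1))) :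
    HasCl c W a := by
  refine HasCl.extend hc (S := {u}) Finset.inter_subset_right (by simpa using hu) (by simp) ha
    ?_ ?_ h
  · intro v hv w hw hvw
    simp at hv hw
    exact absurd (hv.trans hw.symm) hvw
  · intro v hv w hw
    simp at hv
    subst hv
    exact mem_nb.1 (Finset.mem_inter.1 hw).1

lemma card_split {V : Type*} [Fintype V] [DecidableEq V] (c : V → V → Bool) (W : Finset V)
    (u : V) (j : Bool) : W.card ≤ (nb c j u ∩ W).card + (nb c (!j) u ∩ W).card + 1 := by
  have h1 : W ⊆ insert u ((nb c j u ∩ W) ∪ (nb c (!j) u ∩ W)) := by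
    intro v hv
    by_cases hvu : v = u
    · simp [hvu]
    · cases hcv : c u v <;> cases j <;> simp [mem_nb, hv, hvu, hcv]
  have h2 := (Finset.card_le_card h1).trans (Finset.card_insert_le _ _)
  have h3 := Finset.card_union_le (nb c j u ∩ W) (nb c (!j) u ∩ W)
  omega

lemma erdos_szekeres {V : Type*} [Fintype V] [DecidableEq V] {c : V → V → Bool}
    (hc : ∀ v w, c v w = c w v) (N : ℕ) : ∀ (a : Bool → ℕ) (W : Finset V),
    a true + a false = N → N.choose (a true) ≤ W.card → HasCl c W a := by
  induction N with
  | zero =>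
    intro a W h _
    exact ⟨true, ∅, by simp, by simp; omega, by simp⟩
  | succ N ih =>
    intro a W h hW
    by_cases hz : ∃ b, a b = 0
    · obtain ⟨b, hb⟩ := hz
      exact ⟨b, ∅, by simp, by simp [hb], by simp⟩
    push Not at hz
    have h1 := hz true
    have h2 := hz false
    obtain ⟨e, he⟩ : ∃ e, a true = e + 1 := ⟨a true - 1, by omega⟩
    have hpos : 0 < (N + 1).choose (a true) := Nat.choose_pos (by omega)
    obtain ⟨u, hu⟩ := Finset.card_pos.1 (hpos.trans_le hW)
    have h3 := card_split c W u true
    rw [he, Nat.choose_succ_succ'] at hW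
    have h4 : N.choose e ≤ (nb c true u ∩ W).card ∨
        N.choose (e + 1) ≤ (nb c false u ∩ W).card := by
      simp only [Bool.not_true] at h3
      by_contra hcon
      push Not at hcon
      omega
    rcases h4 with h4 | h4
    · refine HasCl.step hc hu (j := true) (by omega) (ih _ _ ?_ ?_)
      · simp; omega
      · simpa [he] using h4
    · refine HasCl.step hc hu (j := false) (by omega) (ih _ _ ?_ ?_)
      · simp; omega
      · simpa [he] using h4

lemma erdos_szekeres' {V : Type*} [Fintype V] [DecidableEq V] {c : V → V → Bool}
    (hc : ∀ v w, c v w = c w v) (N : ℕ) (a : Bool → ℕ) (W : Finset V) (b : Bool)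
    (h : a true + a false = N) (hW : N.choose (a b) ≤ W.card) : HasCl c W a := by
  refine erdos_szekeres hc N a W h ?_
  cases b
  · rwa [← Nat.choose_symm_of_eq_add (show N = a true + a false from h.symm)] at hW
  · exact hW

lemma choose_chernoff (M j : ℕ) (x : ℝ) :
    (M.choose j : ℝ) ≤ 2 ^ M * Real.exp (M * x ^ 2 / 8 - x * (M - 2 * j) / 2) := by
  by_cases hj : M < j
  · rw [Nat.choose_eq_zero_of_lt hj]
    simp only [Nat.cast_zero]
    positivity
  push Not at hj
  have h1 : (M.choose j : ℝ) * Real.exp (-x) ^ j ≤ (Real.exp (-x) + 1) ^ M := by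
    rw [add_pow]
    have := Finset.single_le_sum (s := Finset.range (M + 1))
      (f := fun i => Real.exp (-x) ^ i * 1 ^ (M - i) * (M.choose i : ℝ))
      (fun i _ => by positivity) (Finset.mem_range.2 (Nat.lt_succ_of_le hj))
    simp only [one_pow, mul_one] at this ⊢
    linarith
  have h2 : Real.exp (-x) + 1 = 2 * Real.cosh (x / 2) * Real.exp (-(x / 2)) := by
    rw [Real.cosh_eq]
    have : Real.exp (-x) = Real.exp (-(x / 2)) * Real.exp (-(x / 2)) := by
      rw [← Real.exp_add]; ring_nf
    have h : Real.exp (x / 2) * Real.exp (-(x / 2)) = 1 := by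
      rw [← Real.exp_add]; simp
    rw [this]
    linear_combination (-1 : ℝ) * h
  have h3 : Real.exp (-x) + 1 ≤ 2 * Real.exp (x ^ 2 / 8 - x / 2) := by
    rw [h2, sub_eq_add_neg, Real.exp_add, ← mul_assoc]
    have := Real.cosh_le_exp_half_sq (x / 2)
    have e : (x / 2) ^ 2 / 2 = x ^ 2 / 8 := by ring
    rw [e] at this
    gcongr
  have h4 : (M.choose j : ℝ) * Real.exp (-x) ^ j ≤ (2 * Real.exp (x ^ 2 / 8 - x / 2)) ^ M :=
    h1.trans (by gcongr)
  rw [mul_pow, ← Real.exp_nat_mul, ← Real.exp_nat_mul] at h4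
  have h5 : Real.exp (M * x ^ 2 / 8 - x * (M - 2 * j) / 2)
    = Real.exp (M * (x ^ 2 / 8 - x / 2)) * Real.exp (j * x) := by
    rw [← Real.exp_add]; ring_nf
  have h6 : Real.exp (j * -x) * Real.exp (j * x) = 1 := by
    rw [← Real.exp_add]; simp
  rw [h5, ← mul_assoc]
  calc (M.choose j : ℝ) = M.choose j * Real.exp (j * -x) * Real.exp (j * x) := by
        rw [mul_assoc, h6, mul_one]
    _ ≤ _ := by gcongr

/-! Numerical facts. -/

lemma num_A : 16 * Fb ((810000 : ℕ) : ℝ) ≤ Real.exp 1820 := by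
  unfold Fb
  have h1 : √((810000 : ℕ) : ℝ) = 900 := by
    rw [show ((810000 : ℕ) : ℝ) = 900 ^ 2 by norm_num]
    exact Real.sqrt_sq (by norm_num)
  have h2 : Real.exp 1820 = Real.exp 20 * Real.exp (2 * 900) := by
    rw [← Real.exp_add]; norm_num
  have h3 : (2.7 : ℝ) ^ 20 ≤ Real.exp 20 := by
    have : Real.exp 20 = Real.exp 1 ^ 20 := by rw [← Real.exp_nat_mul]; norm_num
    rw [this]
    have := Real.exp_one_gt_d9
    gcongr
    linarith
  rw [h1, h2]
  have : (16 * (6 * ((810000 : ℕ) : ℝ))) ≤ 2.7 ^ 20 := by norm_num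
  have h4 := this.trans h3
  have := mul_le_mul_of_nonneg_right h4 (Real.exp_pos (2 * 900)).le
  linarith

lemma num_bn (n : ℕ) (hn : 810000 ≤ n) : 1 ≤ bn n * Real.exp (3 * √(n : ℝ)) := by
  have hnr : (810000 : ℝ) ≤ n := by exact_mod_cast hn
  set x := √(n : ℝ) with hx
  have hxn : x ^ 2 = n := Real.sq_sqrt (by positivity)
  have hx9 : 900 ≤ x := by
    rw [hx]
    exact Real.le_sqrt_of_sq_le (by norm_num; linarith)
  have h1 : √((n : ℝ) + 1) ≤ x + 1 := by
    rw [Real.sqrt_le_left (by linarith)]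
    nlinarith
  have h2 : x ^ 9 / 362880 ≤ Real.exp x := by
    have := Real.pow_div_factorial_le_exp x (by linarith) 9
    simpa [Nat.factorial] using this
  have h3 : Real.exp 2 ≤ 9 := by
    have : Real.exp 2 = Real.exp 1 ^ 2 := by rw [← Real.exp_nat_mul]; norm_num
    rw [this]
    have := Real.exp_one_lt_d9
    have h0 := Real.exp_pos 1
    nlinarith
  have h4 : 2 * (6 * ((n : ℝ) + 1)) * (n * (n + 1)) * 9 ≤ Real.exp x := by
    refine le_trans ?_ h2
    rw [← hxn]
    have e1 : x ^ 2 + 1 ≤ 2 * x ^ 2 := by nlinarith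
    have e2 : 2 * (6 * (x ^ 2 + 1)) * (x ^ 2 * (x ^ 2 + 1)) * 9 ≤
        2 * (6 * (2 * x ^ 2)) * (x ^ 2 * (2 * x ^ 2)) * 9 := by gcongr
    refine e2.trans ?_
    have e3 : (900 : ℝ) ^ 3 ≤ x ^ 3 := by gcongr
    have e4 : 0 ≤ x ^ 6 := by positivity
    have e5 := mul_le_mul_of_nonneg_left e3 e4
    rw [le_div_iff₀ (by norm_num)]
    nlinarith
  have h5 : Real.exp (2 * √((n : ℝ) + 1)) ≤ Real.exp (2 * x) * 9 := by
    calc Real.exp (2 * √((n : ℝ) + 1)) ≤ Real.exp (2 * x + 2) := by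
          apply Real.exp_le_exp.2; linarith
      _ = Real.exp (2 * x) * Real.exp 2 := Real.exp_add _ _
      _ ≤ _ := by gcongr
  have h6 : 2 * Fb ((n : ℝ) + 1) * (n * (n + 1)) ≤ Real.exp (3 * x) := by
    have e : Real.exp (3 * x) = Real.exp x * Real.exp (2 * x) := by
      rw [← Real.exp_add]; ring_nf
    rw [e]
    unfold Fb
    calc 2 * (6 * ((n : ℝ) + 1) * Real.exp (2 * √((n : ℝ) + 1))) * (n * (n + 1))
        ≤ 2 * (6 * ((n : ℝ) + 1) * (Real.exp (2 * x) * 9)) * (n * (n + 1)) := by gcongr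
      _ = (2 * (6 * ((n : ℝ) + 1)) * (n * (n + 1)) * 9) * Real.exp (2 * x) := by ring
      _ ≤ _ := by gcongr
  unfold bn
  have : 0 < Fb ((n : ℝ) + 1) := Fb_pos (by positivity)
  rw [one_div_mul_eq_div, le_div_iff₀ (by positivity)]
  linarith

lemma log_lower {y : ℝ} (hy : 0 ≤ y) : y / (1 + y) ≤ Real.log (1 + y) := by
  have := Real.one_sub_inv_le_log_of_pos (show 0 < 1 + y by linarith)
  refine le_trans (le_of_eq ?_) this
  field_simp
  ring

lemma num_kappa (t : ℕ) (ht : 10 ^ 12 ≤ t) (n : ℕ) (hn : 810000 ≤ n)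
    (hnt : (n : ℝ) * (1 / 10 ^ 6) ≤ t) :
    1 ≤ bn n * Real.exp ((t / 100 : ℝ) * Real.log (1 + n / t)) := by
  have htr : (10 : ℝ) ^ 12 ≤ t := by exact_mod_cast ht
  have ht0 : (0 : ℝ) < t := by linarith [show (0 : ℝ) < 10 ^ 12 by norm_num]
  have hnr : (810000 : ℝ) ≤ n := by exact_mod_cast hn
  refine (num_bn n hn).trans ?_
  refine mul_le_mul_of_nonneg_left (Real.exp_le_exp.2 ?_) (bn_pos (show 0 < n by omega)).le
  set x := √(n : ℝ) with hx
  have hxn : x ^ 2 = n := Real.sq_sqrt (by positivity)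
  have hx9 : 900 ≤ x := by
    rw [hx]
    exact Real.le_sqrt_of_sq_le (by norm_num; linarith)
  have hl := log_lower (show 0 ≤ (n : ℝ) / t by positivity)
  have e : (n : ℝ) / t / (1 + n / t) = n / (t + n) := by field_simp
  rw [e] at hl
  refine le_trans ?_ (mul_le_mul_of_nonneg_left hl (show (0 : ℝ) ≤ t / 100 by positivity))
  rcases le_total (n : ℝ) t with h | h
  · have h1 : (n : ℝ) / (2 * t) ≤ n / (t + n) := by
      gcongr
      linarith
    refine le_trans ?_ (mul_le_mul_of_nonneg_left h1 (show (0 : ℝ) ≤ t / 100 by positivity))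
    have : (t / 100 : ℝ) * (n / (2 * t)) = n / 200 := by field_simp; norm_num
    rw [this, ← hxn]
    nlinarith
  · have h1 : (1 : ℝ) / 2 ≤ n / (t + n) := by
      rw [div_le_div_iff₀ (by norm_num) (by positivity)]
      linarith
    refine le_trans ?_ (mul_le_mul_of_nonneg_left h1 (show (0 : ℝ) ≤ t / 100 by positivity))
    have h2 : x ≤ t / 600 := by
      rw [hx, Real.sqrt_le_left (by positivity)]
      nlinarith
    linarith

lemma num_theta (t : ℕ) (ht : 10 ^ 12 ≤ t) :
    1 ≤ (1 / 2 - 15 / 10 ^ 6 : ℝ) *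
      Real.exp ((t / 1080000 : ℝ) * Real.log (1 + (810000 : ℕ) / t)) := by
  have htr : (10 : ℝ) ^ 12 ≤ t := by exact_mod_cast ht
  have ht0 : (0 : ℝ) < t := by linarith [show (0 : ℝ) < 10 ^ 12 by norm_num]
  have hl := log_lower (show 0 ≤ ((810000 : ℕ) : ℝ) / t by positivity)
  have e : ((810000 : ℕ) : ℝ) / t / (1 + (810000 : ℕ) / t) = 810000 / (t + 810000) := by
    push_cast
    field_simp
  rw [e] at hl
  have h1 : (0.74 : ℝ) ≤ (t / 1080000 : ℝ) * Real.log (1 + (810000 : ℕ) / t) := by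
    refine le_trans ?_ (mul_le_mul_of_nonneg_left hl (by positivity))
    rw [mul_div_assoc', le_div_iff₀ (by positivity)]
    nlinarith
  have h2 : (2.08 : ℝ) ≤ Real.exp 0.74 := by
    have : Real.exp 0.74 = Real.exp 0.7 * Real.exp 0.04 := by
      rw [← Real.exp_add]; norm_num
    rw [this]
    have e1 : (2 : ℝ) ≤ Real.exp 0.7 := by
      rw [← Real.log_le_iff_le_exp (by norm_num)]
      linarith [Real.log_two_lt_d9]
    have e2 := Real.add_one_le_exp (0.04 : ℝ)
    nlinarith
  have h3 := h2.trans (Real.exp_le_exp.2 h1)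
  nlinarith

lemma num_Hp (s : ℕ) (hs : 1 ≤ s) :
    (1 / 10 ^ 6 : ℝ) ≤ Hp (10 * s) (1 / 2 - 15 / 10 ^ 6) (1 / 2 - 11 / 10 ^ 6) (10 * s) := by
  unfold Hp
  have hsr : (1 : ℝ) ≤ s := by exact_mod_cast hs
  have h1 := one_add_mul_le_pow (a := -(1 / ((10 * s : ℕ) : ℝ))) (by
    have : (1 : ℝ) / ((10 * s : ℕ) : ℝ) ≤ 1 := by
      rw [div_le_one (by positivity)]; push_cast; linarith
    linarith) (5 * s)
  have h2 : 1 + ((5 * s : ℕ) : ℝ) * -(1 / ((10 * s : ℕ) : ℝ)) = 1 / 2 := by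
    push_cast; field_simp; norm_num
  rw [h2, ← sub_eq_add_neg] at h1
  have h3 : (1 - 1 / ((10 * s : ℕ) : ℝ)) ^ (10 * s) =
      ((1 - 1 / ((10 * s : ℕ) : ℝ)) ^ (5 * s)) ^ 2 := by
    rw [← pow_mul]; ring_nf
  rw [h3]
  nlinarith
/-- The bound proved by induction. -/
noncomputable def gb (k s n : ℕ) : ℝ := 2 ^ n / (1 + 2 / 10 ^ 5 : ℝ) ^ (n - (2 * k - 2 * s))

lemma gb_pos (k s n : ℕ) : 0 < gb k s n := by unfold gb; positivity

lemma gb_ge (k s n : ℕ) (hn : n ≤ 2 * k) (hs : s ≤ k) :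
    Real.exp (n * Real.log 2 - s * (4 / 10 ^ 5)) ≤ gb k s n := by
  unfold gb
  rw [le_div_iff₀ (by positivity), sub_eq_add_neg, Real.exp_add, Real.exp_nat_mul,
    Real.exp_log (by norm_num)]
  have h1 : (1 + 2 / 10 ^ 5 : ℝ) ^ (n - (2 * k - 2 * s)) ≤ (1 + 2 / 10 ^ 5 : ℝ) ^ (2 * s) :=
    pow_le_pow_right₀ (by norm_num) (by omega)
  have h2 : (1 + 2 / 10 ^ 5 : ℝ) ^ (2 * s) ≤ Real.exp (s * (4 / 10 ^ 5)) := by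
    have := Real.add_one_le_exp (2 / 10 ^ 5 : ℝ)
    have h3 : (1 + 2 / 10 ^ 5 : ℝ) ^ (2 * s) ≤ Real.exp (2 / 10 ^ 5) ^ (2 * s) := by
      gcongr
      linarith
    refine h3.trans_eq ?_
    rw [← Real.exp_nat_mul]
    push_cast
    ring_nf
  have h4 := h1.trans h2
  calc (2 : ℝ) ^ n * Real.exp (-(s * (4 / 10 ^ 5))) * (1 + 2 / 10 ^ 5 : ℝ) ^ (n - (2 * k - 2 * s))
      ≤ 2 ^ n * Real.exp (-(s * (4 / 10 ^ 5))) * Real.exp (s * (4 / 10 ^ 5)) := by gcongr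
    _ = 2 ^ n := by rw [mul_assoc, ← Real.exp_add]; simp

lemma log_million : -Real.log (1 / 10 ^ 6 : ℝ) ≤ 14 := by
  rw [one_div, Real.log_inv, neg_neg]
  have h : Real.log (10 ^ 6 : ℝ) ≤ Real.log (2 ^ 20) := Real.log_le_log (by norm_num) (by norm_num)
  rw [Real.log_pow (n := 20)] at h
  push_cast at h
  linarith [Real.log_two_lt_d9]

lemma neg_log_q : -Real.log (1 / 2 - 15 / 10 ^ 6 : ℝ) ≤ Real.log 2 + 3.001 / 10 ^ 5 := by
  have h1 : Real.log (1 / 2 - 15 / 10 ^ 6 : ℝ) = Real.log (1 - 3 / 10 ^ 5 : ℝ) - Real.log 2 := by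
    rw [← Real.log_div (by norm_num) (by norm_num)]
    norm_num
  have h2 := Real.one_sub_inv_le_log_of_pos (show (0 : ℝ) < 1 - 3 / 10 ^ 5 by norm_num)
  have h3 : (1 - 3 / 10 ^ 5 : ℝ)⁻¹ ≤ 1 + 3.001 / 10 ^ 5 := by norm_num
  linarith

lemma main_induction {V : Type*} [Fintype V] [DecidableEq V] {c : V → V → Bool}
    (hc : ∀ v w, c v w = c w v) (k s : ℕ) (hs : 10 ^ 11 ≤ s) (hk1 : 30000 * s ≤ k)
    (hk2 : k ≤ 30000 * (s + 1)) (n : ℕ) :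
    ∀ (a : Bool → ℕ) (W : Finset V), (∀ b, a b ≤ k) → a true + a false = n →
      gb k s n ≤ W.card → HasCl c W a := by
  induction n with
  | zero =>
    intro a W _ h _
    exact ⟨true, ∅, by simp, by simp; omega, by simp⟩
  | succ n ih =>
    intro a W hak hn hW
    have hab : ∀ b, a b + a (!b) = n + 1 := by
      intro b; cases b <;> simp <;> omega
    rcases Nat.lt_or_ge n (2 * k - 2 * s) with hlt | hge
    · -- Erdős–Szekeres
      refine erdos_szekeres hc (n + 1) a W hn ?_
      have h1 : ((n + 1).choose (a true) : ℝ) ≤ W.card := by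
        refine le_trans ?_ hW
        unfold gb
        rw [Nat.sub_eq_zero_of_le hlt, pow_zero, div_one]
        exact_mod_cast Nat.choose_le_two_pow _ _
      exact_mod_cast h1
    -- large case
    have hn2k : n + 1 ≤ 2 * k := by
      have := hak true; have := hak false; omega
    have ha_low : ∀ b, k - 2 * s < a b := by
      intro b
      have := hak (!b); have := hab b
      omega
    by_cases hstep : ∃ u ∈ W, ∃ j, gb k s n ≤ (nb c j u ∩ W).card
    · obtain ⟨u, hu, j, hj⟩ := hstep
      have := ha_low j
      refine HasCl.step hc hu (j := j) (by omega) (ih _ _ ?_ ?_ hj)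
      · intro b
        have := hak b
        by_cases hbj : b = j
        · subst hbj; rw [Function.update_self]; omega
        · rwa [Function.update_of_ne hbj]
      · cases j <;> simp <;> omega
    push Not at hstep
    have hsr : (10 : ℝ) ^ 11 ≤ s := by exact_mod_cast hs
    have hs0 : (0 : ℝ) < s := by linarith [show (0 : ℝ) < 10 ^ 11 by norm_num]
    have hk1r : (30000 : ℝ) * s ≤ k := by exact_mod_cast hk1
    have hk2r : (k : ℝ) ≤ 30000 * (s + 1) := by exact_mod_cast hk2
    have hnlow : (2 : ℝ) * k - 2 * s ≤ (n + 1 : ℕ) := by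
      have : 2 * k ≤ (n + 1) + 2 * s := by omega
      have h : ((2 * k : ℕ) : ℝ) ≤ ((n + 1 + 2 * s : ℕ) : ℝ) := by exact_mod_cast this
      push_cast at h ⊢
      linarith
    have hlog2 := Real.log_two_gt_d9
    have hgge := gb_ge k s (n + 1) hn2k (by omega)
    have hWX : Real.exp (36405 * s) ≤ W.card := by
      refine le_trans (Real.exp_le_exp.2 ?_) (hgge.trans hW)
      nlinarith
    have hWbig : (10 : ℝ) ^ 6 ≤ W.card := by
      have := Real.add_one_le_exp (36405 * (s : ℝ))
      nlinarith
    have hgr : gb k s n = (1 / 2 + 1 / 10 ^ 5) * gb k s (n + 1) := by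
      unfold gb
      obtain ⟨e, he⟩ : ∃ e, n = (2 * k - 2 * s) + e := ⟨n - (2 * k - 2 * s), by omega⟩
      have h1 : n - (2 * k - 2 * s) = e := by omega
      have h2 : n + 1 - (2 * k - 2 * s) = e + 1 := by omega
      rw [h1, h2, pow_succ (2 : ℝ) n, pow_succ (1 + 2 / 10 ^ 5 : ℝ) e]
      field_simp
    have hdeg : ∀ b, ∀ x ∈ W, (1 / 2 - 11 / 10 ^ 6 : ℝ) * W.card ≤ (nb c b x ∩ W).card := by
      intro b x hx
      have h1 : (W.card : ℝ) ≤ (nb c b x ∩ W).card + (nb c (!b) x ∩ W).card + 1 := by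
        exact_mod_cast card_split c W x b
      have h2 := hstep x hx (!b)
      rw [hgr] at h2
      have h3 : (1 / 2 + 1 / 10 ^ 5) * gb k s (n + 1) ≤ (1 / 2 + 1 / 10 ^ 5) * W.card := by gcongr
      linarith
    have htc : ((10 * s : ℕ) : ℝ) = 10 * s := by push_cast; ring
    have hHlog : -Real.log (Hp (10 * s) (1 / 2 - 15 / 10 ^ 6) (1 / 2 - 11 / 10 ^ 6) (10 * s)) ≤ 14 := by
      have h := Real.log_le_log (by norm_num) (num_Hp s (by omega))
      linarith [log_million]
    have hbook := book_induction c hc (10 * s) 810000 (by omega) (by norm_num)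
      (1 / 2 - 15 / 10 ^ 6) (1 / 10 ^ 6) 1820 (((10 * s : ℕ) : ℝ) / 100)
      (((10 * s : ℕ) : ℝ) / 1080000) (by norm_num) (by norm_num) (by positivity) (by positivity)
      (fun b => ((n + 1 - 10 * s).choose (a b - 10 * s) : ℝ)) ?_ num_A
      (fun m hm hm' => num_kappa (10 * s) (by omega) m hm hm') (num_theta (10 * s) (by omega))
      _ W (fun _ => W) (fun _ => 1 / 2 - 11 / 10 ^ 6) (fun _ => 10 * s) le_rfl hdeg
      (fun _ => by norm_num) (fun _ => num_Hp s (by omega)) ?_ ?_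
    · obtain ⟨b, S, hS, M, hM, hSc, hMc, hcl, hSM⟩ := hbook
      have hSc' : S.card = 10 * s := hSc
      have hMc' : ((n + 1 - 10 * s).choose (a b - 10 * s) : ℝ) ≤ M.card := hMc
      have h1 := ha_low b
      have h2 := hab b
      refine HasCl.extend hc (t := 10 * s) hM hS hSc' (by omega) hcl hSM ?_
      refine erdos_szekeres' hc (n + 1 - 10 * s) _ M b ?_ ?_
      · cases b <;> simp at h1 h2 ⊢ <;> omega
      · rw [Function.update_self]
        exact_mod_cast hMc'
    · intro b
      have h1 := ha_low b
      have h2 := hab b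
      have : 0 < (n + 1 - 10 * s).choose (a b - 10 * s) := Nat.choose_pos (by omega)
      exact_mod_cast this
    · refine le_trans (Real.exp_le_exp.2 ?_) hWX
      simp only [Finset.sum_const, Finset.card_univ, Fintype.card_bool, nsmul_eq_mul]
      rw [htc]
      push_cast
      have := mul_le_mul_of_nonneg_left hHlog (show 0 ≤ 10 * (s : ℝ) / 100 by positivity)
      linarith
    · intro b
      refine le_trans ?_ (hgge.trans hW)
      have h1 := ha_low b
      have h2 := hab b
      have h3 := hak b
      have hM : ((n + 1 - 10 * s : ℕ) : ℝ) = (n + 1 : ℕ) - 10 * s := by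
        rw [Nat.cast_sub (by omega)]; push_cast; ring
      have hJ : ((a b - 10 * s : ℕ) : ℝ) = a b - 10 * s := by
        rw [Nat.cast_sub (by omega)]; push_cast; ring
      have hch := choose_chernoff (n + 1 - 10 * s) (a b - 10 * s) (8 / 30000)
      have h2pow : (2 : ℝ) ^ (n + 1 - 10 * s) = Real.exp (((n + 1 - 10 * s : ℕ) : ℝ) * Real.log 2) := by
        rw [Real.exp_nat_mul, Real.exp_log (by norm_num)]
      rw [h2pow, ← Real.exp_add] at hch
      refine le_trans (mul_le_mul_of_nonneg_right hch (Real.exp_pos _).le) ?_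
      rw [← Real.exp_add]
      apply Real.exp_le_exp.2
      rw [hM, hJ, htc]
      have e1 := mul_le_mul_of_nonneg_left hHlog (show 0 ≤ 10 * (s : ℝ) / 1080000 by positivity)
      have e2 := mul_le_mul_of_nonneg_left neg_log_q (show 0 ≤ 10 * (s : ℝ) by positivity)
      have e3 : (a b : ℝ) ≤ k := by exact_mod_cast h3
      have e4 : ((n + 1 : ℕ) : ℝ) ≤ 2 * k := by exact_mod_cast hn2k
      generalize ((n + 1 : ℕ) : ℝ) = nn at *
      generalize Real.log 2 = L at *
      generalize -Real.log (1 / 2 - 15 / 10 ^ 6 : ℝ) = Q at *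
      have hsr' : (1000 : ℝ) ≤ s := le_trans (by norm_num) hsr
      norm_num at e1 e2 ⊢
      linarith

theorem ramsey_le_two_pow_eta :
    ∃ k₀ : ℕ, ∀ k : ℕ, k₀ ≤ k →
      (ramsey k : ℝ) ≤ (2 : ℝ) ^ ((2 - (1 / 8000 : ℝ) ^ 2 / 10) * k) := by
  refine ⟨30000 * 10 ^ 11, fun k hk => ?_⟩
  obtain ⟨s, hs⟩ : ∃ s, s = k / 30000 := ⟨_, rfl⟩
  have hs1 : 10 ^ 11 ≤ s := by omega
  have hk1 : 30000 * s ≤ k := by omega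
  have hk2 : k ≤ 30000 * (s + 1) := by omega
  have hmem : ramsey k ≤ ⌈gb k s (2 * k)⌉₊ := by
    refine Nat.sInf_le ?_
    intro c hc
    obtain ⟨b, S, _, hSc, hS⟩ := main_induction hc k s hs1 hk1 hk2 (2 * k) (fun _ => k) Finset.univ
      (fun _ => le_rfl) (by ring) (by rw [Finset.card_univ, Fintype.card_fin]; exact Nat.le_ceil _)
    exact ⟨S, b, hSc, hS⟩
  have h1 : (ramsey k : ℝ) ≤ gb k s (2 * k) + 1 := by
    have : (ramsey k : ℝ) ≤ (⌈gb k s (2 * k)⌉₊ : ℝ) := by exact_mod_cast hmem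
    exact this.trans (Nat.ceil_lt_add_one (gb_pos _ _ _).le).le
  refine h1.trans ?_
  have hsr : (10 : ℝ) ^ 11 ≤ s := by exact_mod_cast hs1
  have hk1r : (30000 : ℝ) * s ≤ k := by exact_mod_cast hk1
  have hk2r : (k : ℝ) ≤ 30000 * (s + 1) := by exact_mod_cast hk2
  have hl1 := Real.log_two_gt_d9
  have hl2 := Real.log_two_lt_d9
  have h2 : 1 ≤ gb k s (2 * k) := by
    refine le_trans (Real.one_le_exp ?_) (gb_ge k s (2 * k) le_rfl (by omega))
    push_cast
    nlinarith
  have h3 : gb k s (2 * k) ≤ Real.exp (2 * k * Real.log 2 - s * (3.9999 / 10 ^ 5)) := by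
    unfold gb
    have e : 2 * k - (2 * k - 2 * s) = 2 * s := by omega
    have hl := log_lower (show (0 : ℝ) ≤ 2 / 10 ^ 5 by norm_num)
    have h4 : Real.exp (s * (3.9999 / 10 ^ 5)) ≤ (1 + 2 / 10 ^ 5 : ℝ) ^ (2 * s) := by
      have : (1 + 2 / 10 ^ 5 : ℝ) ^ (2 * s) = Real.exp ((2 * s : ℕ) * Real.log (1 + 2 / 10 ^ 5)) := by
        rw [Real.exp_nat_mul, Real.exp_log (by norm_num)]
      rw [this]
      apply Real.exp_le_exp.2
      push_cast
      have h5 : (3.9999 / 10 ^ 5 : ℝ) ≤ 2 * Real.log (1 + 2 / 10 ^ 5) := by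
        refine le_trans ?_ (mul_le_mul_of_nonneg_left hl (by norm_num))
        norm_num
      nlinarith
    rw [e, div_le_iff₀ (by positivity)]
    have h6 : (2 : ℝ) ^ (2 * k) = Real.exp (2 * k * Real.log 2) := by
      rw [show (2 : ℝ) * k = ((2 * k : ℕ) : ℝ) by push_cast; ring, Real.exp_nat_mul,
        Real.exp_log (by norm_num)]
    rw [h6]
    calc Real.exp (2 * k * Real.log 2) = Real.exp (2 * k * Real.log 2 - s * (3.9999 / 10 ^ 5)) *
          Real.exp (s * (3.9999 / 10 ^ 5)) := by rw [← Real.exp_add]; ring_nf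
      _ ≤ _ := by gcongr
  have h7 : gb k s (2 * k) + 1 ≤ 2 * gb k s (2 * k) := by linarith
  refine h7.trans ?_
  have h8 : 2 * gb k s (2 * k) ≤ Real.exp (Real.log 2) *
      Real.exp (2 * k * Real.log 2 - s * (3.9999 / 10 ^ 5)) := by
    rw [Real.exp_log (by norm_num)]
    linarith
  refine h8.trans ?_
  rw [← Real.exp_add, Real.rpow_def_of_pos (by norm_num)]
  apply Real.exp_le_exp.2
  have h9 : (k : ℝ) * Real.log 2 ≤ 30000 * (s + 1) * 0.6931471808 := by
    apply mul_le_mul hk2r hl2.le (by linarith) (by positivity)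
  nlinarith
end

section
/- Let X, Y, Z be disjoint nonempty sets of vertices in a two-colored complete graph and let α_R, α_B ∈ (0,1). Set p_R = d_R(X,Y) and p_B = d_B(X,Z), and assume every vertex of X has exactly p_R·|Y| red neighbors in Y and exactly p_B·|Z| blue neighbors in Z. Then there exist a vertex v ∈ X, a subset X' ⊆ X, and a real number κ ≥ 0 such that, writing Y' = Y ∩ N_R(v) and Z' = Z ∩ N_B(v): (i) |X'| ≥ (1/8)·2^{-6κ}·|X|; (ii) d_R(X',Y') ≥ p_R - α_R and d_B(X',Z') ≥ p_B - α_B; and (iii) d_R(X',Y') ≥ p_R + (κ²-1)α_R or d_B(X',Z') ≥ p_B + (κ²-1)α_B. -/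
open Finset

variable {V : Type*} [DecidableEq V]

/-- The number of red edges between `X` and `Y` (coloring `c`, `true` = red). -/
def redEdges (c : V → V → Bool) (X Y : Finset V) : ℕ :=
  ((X ×ˢ Y).filter fun p => c p.1 p.2 = true).card

/-- The number of blue edges between `X` and `Y`. -/
def blueEdges (c : V → V → Bool) (X Y : Finset V) : ℕ :=
  ((X ×ˢ Y).filter fun p => c p.1 p.2 = false).card

/-- The red density `d_R(X,Y)` between `X` and `Y`. -/
noncomputable def redDensity (c : V → V → Bool) (X Y : Finset V) : ℝ :=
  (redEdges c X Y : ℝ) / ((X.card : ℝ) * (Y.card : ℝ))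

/-- The blue density `d_B(X,Y)` between `X` and `Y`. -/
noncomputable def blueDensity (c : V → V → Bool) (X Y : Finset V) : ℝ :=
  (blueEdges c X Y : ℝ) / ((X.card : ℝ) * (Y.card : ℝ))

/-- `C x = ∑ xⁿ/(2n)!`, i.e. `cosh √x` for `x ≥ 0` and `cos √(-x)` for `x < 0`. -/
noncomputable def Cfun (x : ℝ) : ℝ :=
  if 0 ≤ x then Real.cosh (Real.sqrt x) else Real.cos (Real.sqrt (-x))

lemma Cfun_hasSum (x : ℝ) : HasSum (fun n : ℕ => x ^ n / ((2 * n).factorial : ℝ)) (Cfun x) := by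
  unfold Cfun
  split_ifs with h
  · have := Real.hasSum_cosh (Real.sqrt x)
    convert this using 3 with n
    rw [pow_mul, Real.sq_sqrt h]
  · have := Real.hasSum_cos (Real.sqrt (-x))
    convert this using 3 with n
    rw [pow_mul, Real.sq_sqrt (by linarith), ← mul_pow]
    simp

lemma Cfun_ge_neg_one (x : ℝ) : -1 ≤ Cfun x := by
  unfold Cfun
  split_ifs with h
  · linarith [Real.one_le_cosh (Real.sqrt x)]
  · exact Real.neg_one_le_cos _

lemma Cfun_le_one {x : ℝ} (hx : x ≤ 0) : Cfun x ≤ 1 := by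
  unfold Cfun
  split_ifs with h
  · have : x = 0 := le_antisymm hx h
    simp [this]
  · exact Real.cos_le_one _

lemma Cfun_mono {x y : ℝ} (hxy : x ≤ y) (hy : 0 ≤ y) : Cfun x ≤ Cfun y := by
  by_cases h : 0 ≤ x
  · unfold Cfun
    rw [if_pos h, if_pos hy, Real.cosh_le_cosh, abs_of_nonneg (Real.sqrt_nonneg _),
      abs_of_nonneg (Real.sqrt_nonneg _)]
    exact Real.sqrt_le_sqrt hxy
  · refine (Cfun_le_one (by linarith)).trans ?_
    unfold Cfun
    rw [if_pos hy]
    exact Real.one_le_cosh _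

lemma Cfun_lower {x : ℝ} (hx : 0 ≤ x) : 1 + x / 2 + x ^ 2 / 24 ≤ Cfun x := by
  have := sum_le_hasSum (Finset.range 3) (fun i _ => by positivity) (Cfun_hasSum x)
  simp [Finset.sum_range_succ, Nat.factorial] at this
  linarith

lemma aux_k (k : ℕ) (hk : 1 ≤ k) : (k : ℝ) * (k + 2) ≤ 3 / 4 * 4 ^ k := by
  induction k, hk using Nat.le_induction with
  | base => norm_num
  | succ n hn ih =>
    have : (1 : ℝ) ≤ n := by exact_mod_cast hn
    push_cast
    rw [pow_succ]
    nlinarith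

lemma Cfun_upper (k : ℕ) (hk : 1 ≤ k) :
    2 + Cfun (3 * (k * (k + 2))) ≤ 2 * 8 ^ k := by
  have hk' : (1 : ℝ) ≤ k := by exact_mod_cast hk
  have h0 : (0 : ℝ) ≤ 3 * (k * (k + 2)) := by positivity
  have h1 : Cfun (3 * (k * (k + 2))) ≤ Real.cosh (2 * k + 1) := by
    unfold Cfun
    rw [if_pos h0, Real.cosh_le_cosh, abs_of_nonneg (Real.sqrt_nonneg _),
      abs_of_nonneg (by positivity)]
    apply Real.sqrt_le_iff.2 ⟨by positivity, ?_⟩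
    nlinarith [sq_nonneg ((k : ℝ) - 1)]
  have h2 : Real.exp (-(2 * k + 1 : ℝ)) ≤ 1 := Real.exp_le_one_iff.2 (by linarith)
  have h3 : Real.exp (2 * k + 1 : ℝ) ≤ 2.72 * 8 ^ k := by
    have : (2 * k + 1 : ℝ) = 1 + k * 2 := by ring
    rw [this, Real.exp_add, Real.exp_nat_mul]
    have he := Real.exp_one_lt_d9
    have he2 : Real.exp 2 ≤ 8 := by
      have : (2 : ℝ) = 1 + 1 := by norm_num
      rw [this, Real.exp_add]
      nlinarith [Real.exp_pos 1]
    gcongr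
    linarith
  have h8 : (8 : ℝ) ≤ 8 ^ k := by
    calc (8 : ℝ) = 8 ^ 1 := by norm_num
      _ ≤ 8 ^ k := pow_le_pow_right₀ (by norm_num) hk
  rw [Real.cosh_eq] at h1
  linarith

/-- The test function. -/
noncomputable def Ffun (A B : ℝ) : ℝ := A * (2 + Cfun B) + B * (2 + Cfun A)

lemma Ffun_comm (A B : ℝ) : Ffun A B = Ffun B A := by unfold Ffun; ring

lemma Ffun_bad {A : ℝ} (B : ℝ) (hA : A ≤ -3) : Ffun A B ≤ -3 := by
  unfold Ffun
  have hB1 := Cfun_ge_neg_one B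
  have hA1 := Cfun_ge_neg_one A
  have hA2 := Cfun_le_one (show A ≤ 0 by linarith)
  rcases le_total B 0 with h | h
  · nlinarith
  · have := Cfun_lower h
    have e1 : A * (2 + Cfun B) ≤ -3 * (2 + Cfun B) :=
      mul_le_mul_of_nonneg_right hA (by linarith)
    have e2 : B * (2 + Cfun A) ≤ B * 3 := mul_le_mul_of_nonneg_left (by linarith) h
    nlinarith [sq_nonneg (B - 6)]

lemma Ffun_nonpos {A B : ℝ} (hA : A ≤ 0) (hB : B ≤ 0) : Ffun A B ≤ 0 := by
  unfold Ffun
  have hB1 := Cfun_ge_neg_one B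
  have hA1 := Cfun_ge_neg_one A
  nlinarith

lemma Ffun_shell {a b : ℝ} (k : ℕ) (hk : 1 ≤ k) (hab : b ≤ a) (ha : 0 ≤ a)
    (hak : a ≤ k * (k + 2)) : Ffun (3 * a) (3 * b) ≤ 9 * 32 ^ k := by
  have h1 : Ffun (3 * a) (3 * b) ≤ 2 * (3 * a) * (2 + Cfun (3 * a)) := by
    unfold Ffun
    have e1 := Cfun_mono (show 3 * b ≤ 3 * a by linarith) (by linarith)
    have e2 := Cfun_ge_neg_one (3 * a)
    nlinarith
  have h2 : Cfun (3 * a) ≤ Cfun (3 * (k * (k + 2))) := Cfun_mono (by linarith) (by positivity)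
  have h3 := Cfun_upper k hk
  have h4 := aux_k k hk
  have e2 := Cfun_ge_neg_one (3 * a)
  calc _ ≤ _ := h1
    _ ≤ 2 * (3 * (3 / 4 * 4 ^ k)) * (2 * 8 ^ k) := by
      apply mul_le_mul <;> first | positivity | linarith
    _ = 9 * 32 ^ k := by
      rw [show (32 : ℝ) = 4 * 8 by norm_num, mul_pow]; ring

lemma shell_index {a : ℝ} (ha : 0 < a) : ∃ k : ℕ, 1 ≤ k ∧ (k : ℝ) ^ 2 - 1 ≤ a ∧
    a ≤ k * (k + 2) := by
  refine ⟨⌊Real.sqrt (1 + a)⌋₊, ?_, ?_, ?_⟩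
  · rw [Nat.one_le_floor_iff]
    exact Real.one_le_sqrt.2 (by linarith)
  · have h := Nat.floor_le (Real.sqrt_nonneg (1 + a))
    have := Real.sq_sqrt (show 0 ≤ 1 + a by linarith)
    have h0 : (0 : ℝ) ≤ ⌊Real.sqrt (1 + a)⌋₊ := by positivity
    nlinarith
  · have h := (Nat.lt_floor_add_one (Real.sqrt (1 + a))).le
    have := Real.sq_sqrt (show 0 ≤ 1 + a by linarith)
    have h0 := Real.sqrt_nonneg (1 + a)
    nlinarith

open Classical in
/-- Pointwise bound, oriented. -/
lemma pointwise_aux (a b : ℝ) (K : ℕ) (hab : b ≤ a) (haK : a ≤ K) :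
    Ffun (3 * a) (3 * b) ≤ -3 + (if -1 ≤ a ∧ -1 ≤ b then 3 else 0) +
      ∑ k ∈ Finset.Icc 1 (K + 1), 9 * (32 : ℝ) ^ k *
        (if (k : ℝ) ^ 2 - 1 ≤ a ∧ -1 ≤ b then 1 else 0) := by
  have hnn : 0 ≤ ∑ k ∈ Finset.Icc 1 (K + 1), 9 * (32 : ℝ) ^ k *
        (if (k : ℝ) ^ 2 - 1 ≤ a ∧ -1 ≤ b then (1 : ℝ) else 0) :=
    Finset.sum_nonneg fun k _ => by split_ifs <;> positivity
  by_cases hb : -1 ≤ b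
  · rw [if_pos ⟨hb.trans hab, hb⟩]
    rcases le_or_gt a 0 with ha | ha
    · have := Ffun_nonpos (show 3 * a ≤ 0 by linarith) (show 3 * b ≤ 0 by linarith)
      linarith
    · obtain ⟨k, hk1, hk2, hk3⟩ := shell_index ha
      have h1 := Ffun_shell k hk1 hab ha.le hk3
      have hkK : k ≤ K + 1 := by
        have : (1 : ℝ) ≤ k := by exact_mod_cast hk1
        have : (k : ℝ) ≤ K + 1 := by nlinarith
        exact_mod_cast this
      have h2 := Finset.single_le_sum (s := Finset.Icc 1 (K + 1)) (f := fun k : ℕ =>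
        9 * (32 : ℝ) ^ k * (if (k : ℝ) ^ 2 - 1 ≤ a ∧ -1 ≤ b then (1 : ℝ) else 0))
        (fun k _ => by split_ifs <;> positivity) (Finset.mem_Icc.2 ⟨hk1, hkK⟩)
      simp only [if_pos (And.intro hk2 hb), mul_one] at h2
      linarith
  · rw [if_neg (fun h => hb h.2), Ffun_comm]
    have := Ffun_bad (A := 3 * b) (3 * a) (by linarith)
    linarith

open Classical in
lemma pointwise (a b : ℝ) (K : ℕ) (haK : a ≤ K) (hbK : b ≤ K) :
    Ffun (3 * a) (3 * b) ≤ -3 + (if -1 ≤ a ∧ -1 ≤ b then 3 else 0) +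
      ∑ k ∈ Finset.Icc 1 (K + 1), 9 * (32 : ℝ) ^ k *
        ((if (k : ℝ) ^ 2 - 1 ≤ a ∧ -1 ≤ b then 1 else 0) +
         (if (k : ℝ) ^ 2 - 1 ≤ b ∧ -1 ≤ a then 1 else 0)) := by
  simp only [mul_add, Finset.sum_add_distrib]
  have hnn : ∀ a b : ℝ, 0 ≤ ∑ k ∈ Finset.Icc 1 (K + 1), 9 * (32 : ℝ) ^ k *
        (if (k : ℝ) ^ 2 - 1 ≤ a ∧ -1 ≤ b then (1 : ℝ) else 0) := fun a b =>
    Finset.sum_nonneg fun k _ => by split_ifs <;> positivity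
  rcases le_total b a with h | h
  · linarith [pointwise_aux a b K h haK, hnn b a]
  · have := pointwise_aux b a K h hbK
    rw [Ffun_comm] at this
    simp only [and_comm (a := -1 ≤ b) (b := -1 ≤ a)] at this
    linarith [hnn a b]

/-- Positivity of the kernel `a * b ^ n`. -/
lemma kernel_pos {V : Type*} (X Y Z : Finset V) (s t : V → V → ℝ) (n : ℕ) :
    ∀ w : V → ℝ, 0 ≤ ∑ x ∈ X, ∑ y ∈ X, w x * w y *
      ((∑ i ∈ Y, s x i * s y i) * (∑ j ∈ Z, t x j * t y j) ^ n) := by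
  induction n with
  | zero =>
    intro w
    have : ∑ x ∈ X, ∑ y ∈ X, w x * w y *
        ((∑ i ∈ Y, s x i * s y i) * (∑ j ∈ Z, t x j * t y j) ^ 0) =
        ∑ i ∈ Y, (∑ x ∈ X, w x * s x i) ^ 2 := by
      simp only [pow_zero, mul_one, sq, Finset.sum_mul_sum]
      rw [Finset.sum_comm (s := Y)]
      refine Finset.sum_congr rfl fun x _ => ?_
      rw [Finset.sum_comm (s := Y)]
      refine Finset.sum_congr rfl fun y _ => ?_
      rw [Finset.mul_sum]
      exact Finset.sum_congr rfl fun i _ => by ring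
    rw [this]
    positivity
  | succ n ih =>
    intro w
    have : ∑ x ∈ X, ∑ y ∈ X, w x * w y *
        ((∑ i ∈ Y, s x i * s y i) * (∑ j ∈ Z, t x j * t y j) ^ (n + 1)) =
        ∑ j ∈ Z, ∑ x ∈ X, ∑ y ∈ X, (w x * t x j) * (w y * t y j) *
      ((∑ i ∈ Y, s x i * s y i) * (∑ j ∈ Z, t x j * t y j) ^ n) := by
      rw [Finset.sum_comm (s := Z)]
      refine Finset.sum_congr rfl fun x _ => ?_
      rw [Finset.sum_comm (s := Z)]
      refine Finset.sum_congr rfl fun y _ => ?_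
      rw [← Finset.sum_mul, pow_succ]
      have : ∑ j ∈ Z, w x * t x j * (w y * t y j) = w x * w y * ∑ j ∈ Z, t x j * t y j := by
        rw [Finset.mul_sum]
        exact Finset.sum_congr rfl fun j _ => by ring
      rw [this]
      ring
    rw [this]
    exact Finset.sum_nonneg fun j _ => ih _

lemma kernel_half_pos {V : Type*} (X Y Z : Finset V) (s t : V → V → ℝ) (cA cB : ℝ) (hA : 0 ≤ cA)
    (hB : 0 ≤ cB) :
    0 ≤ ∑ x ∈ X, ∑ y ∈ X, (3 * (cA * ∑ i ∈ Y, s x i * s y i)) *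
      (2 + Cfun (3 * (cB * ∑ j ∈ Z, t x j * t y j))) := by
  have key : ∀ n : ℕ, 0 ≤ ∑ x ∈ X, ∑ y ∈ X, (3 * (cA * ∑ i ∈ Y, s x i * s y i)) *
      ((3 * (cB * ∑ j ∈ Z, t x j * t y j)) ^ n / ((2 * n).factorial : ℝ)) := by
    intro n
    have h := kernel_pos X Y Z s t n (fun _ => 1)
    have : ∑ x ∈ X, ∑ y ∈ X, (3 * (cA * ∑ i ∈ Y, s x i * s y i)) *
      ((3 * (cB * ∑ j ∈ Z, t x j * t y j)) ^ n / ((2 * n).factorial : ℝ)) =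
      (3 * cA * (3 * cB) ^ n / ((2 * n).factorial : ℝ)) * ∑ x ∈ X, ∑ y ∈ X, (1 : ℝ) * 1 *
      ((∑ i ∈ Y, s x i * s y i) * (∑ j ∈ Z, t x j * t y j) ^ n) := by
      simp only [Finset.mul_sum (s := X)]
      refine Finset.sum_congr rfl fun x _ => Finset.sum_congr rfl fun y _ => ?_
      rw [mul_pow, mul_pow, mul_pow]
      ring
    rw [this]
    exact mul_nonneg (by positivity) h
  have h0 : 0 ≤ ∑ x ∈ X, ∑ y ∈ X, 3 * (cA * ∑ i ∈ Y, s x i * s y i) := by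
    simpa using key 0
  have hs : HasSum (fun n : ℕ => ∑ x ∈ X, ∑ y ∈ X, (3 * (cA * ∑ i ∈ Y, s x i * s y i)) *
      ((3 * (cB * ∑ j ∈ Z, t x j * t y j)) ^ n / ((2 * n).factorial : ℝ)))
      (∑ x ∈ X, ∑ y ∈ X, (3 * (cA * ∑ i ∈ Y, s x i * s y i)) *
      (Cfun (3 * (cB * ∑ j ∈ Z, t x j * t y j)))) :=
    hasSum_sum fun x _ => hasSum_sum fun y _ => (Cfun_hasSum _).mul_left _
  have h1 := hs.nonneg key
  simp only [mul_add, Finset.sum_add_distrib]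
  simp only [← Finset.sum_mul]
  linarith

open Classical in
lemma core {V : Type*} (X Y Z : Finset V) (hX : X.Nonempty) (s t : V → V → ℝ) (cA cB : ℝ)
    (hA : 0 ≤ cA) (hB : 0 ≤ cB) (a b : V → V → ℝ)
    (ha : ∀ x y, a x y = cA * ∑ i ∈ Y, s x i * s y i)
    (hb : ∀ x y, b x y = cB * ∑ i ∈ Z, t x i * t y i) :
    ∃ v ∈ X, ∃ k : ℕ,
      ((1 / 8 : ℝ) * (64 ^ k)⁻¹ * X.card ≤
        ((X.filter fun x => (k : ℝ) ^ 2 - 1 ≤ a v x ∧ -1 ≤ b v x).card : ℝ)) ∨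
      ((1 / 8 : ℝ) * (64 ^ k)⁻¹ * X.card ≤
        ((X.filter fun x => (k : ℝ) ^ 2 - 1 ≤ b v x ∧ -1 ≤ a v x).card : ℝ)) := by
  by_contra hcon
  push Not at hcon
  have hpos : 0 ≤ ∑ v ∈ X, ∑ x ∈ X, Ffun (3 * a v x) (3 * b v x) := by
    have h1 := kernel_half_pos X Y Z s t cA cB hA hB
    have h2 := kernel_half_pos X Z Y t s cB cA hB hA
    unfold Ffun
    simp only [Finset.sum_add_distrib, ha, hb]
    linarith
  obtain ⟨K, hK⟩ : ∃ K : ℕ, ∀ v ∈ X, ∀ x ∈ X, a v x ≤ K ∧ b v x ≤ K := by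
    obtain ⟨K, hK⟩ := exists_nat_ge (∑ v ∈ X, ∑ x ∈ X, (|a v x| + |b v x|))
    refine ⟨K, fun v hv x hx => ?_⟩
    have h1 : |a v x| + |b v x| ≤ ∑ x ∈ X, (|a v x| + |b v x|) :=
      Finset.single_le_sum (f := fun x => |a v x| + |b v x|) (fun _ _ => by positivity) hx
    have h2 : ∑ x ∈ X, (|a v x| + |b v x|) ≤ ∑ v ∈ X, ∑ x ∈ X, (|a v x| + |b v x|) :=
      Finset.single_le_sum (f := fun v => ∑ x ∈ X, (|a v x| + |b v x|))
        (fun _ _ => by positivity) hv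
    constructor
    · linarith [le_abs_self (a v x), abs_nonneg (b v x)]
    · linarith [le_abs_self (b v x), abs_nonneg (a v x)]
  have hn : (0 : ℝ) < X.card := by exact_mod_cast hX.card_pos
  have hneg : ∑ v ∈ X, ∑ x ∈ X, Ffun (3 * a v x) (3 * b v x) < 0 := by
    apply Finset.sum_neg _ hX
    intro v hv
    have h1 := Finset.sum_le_sum fun x hx =>
      pointwise (a v x) (b v x) K (hK v hv x hx).1 (hK v hv x hx).2
    refine h1.trans_lt ?_
    rw [Finset.sum_add_distrib, Finset.sum_add_distrib, Finset.sum_comm]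
    simp only [← Finset.mul_sum, Finset.sum_add_distrib]
    have e0 : ∑ x ∈ X, (if -1 ≤ a v x ∧ -1 ≤ b v x then (3 : ℝ) else 0) ≤
        3 * (1 / 8 * X.card) := by
      have := (hcon v hv 0).1
      rw [← Finset.sum_filter, Finset.sum_const, nsmul_eq_mul]
      norm_num at this
      linarith
    have e1 : ∑ k ∈ Finset.Icc 1 (K + 1), 9 * (32 : ℝ) ^ k *
        (∑ x ∈ X, (if (k : ℝ) ^ 2 - 1 ≤ a v x ∧ -1 ≤ b v x then (1 : ℝ) else 0) +
         ∑ x ∈ X, (if (k : ℝ) ^ 2 - 1 ≤ b v x ∧ -1 ≤ a v x then (1 : ℝ) else 0)) ≤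
        ∑ k ∈ Finset.Icc 1 (K + 1), (9 / 4 * X.card) * (1 / 2 : ℝ) ^ k := by
      refine Finset.sum_le_sum fun k _ => ?_
      have hc := hcon v hv k
      simp only [← Finset.sum_filter, Finset.sum_const, nsmul_eq_mul, mul_one]
      have : 9 / 4 * X.card * (1 / 2 : ℝ) ^ k = 9 * (32 : ℝ) ^ k *
          (2 * ((1 / 8 : ℝ) * (64 ^ k)⁻¹ * X.card)) := by
        rw [show (64 : ℝ) = 32 * 2 by norm_num, mul_pow, one_div, inv_pow, mul_inv]
        field_simp
        norm_num
      rw [this]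
      gcongr
      linarith [hc.1, hc.2]
    have e2 : ∀ K : ℕ, ∑ k ∈ Finset.Icc 1 K, (1 / 2 : ℝ) ^ k = 1 - (1 / 2) ^ K := by
      intro K
      induction K with
      | zero => simp
      | succ m ih =>
        rw [Finset.sum_Icc_succ_top (by omega), ih]
        ring
    rw [← Finset.mul_sum, e2] at e1
    have e3 : (0 : ℝ) < (1 / 2) ^ (K + 1) := by positivity
    have e4 : ∑ x ∈ X, (-3 : ℝ) = -3 * X.card := by simp; ring
    rw [e4]
    nlinarith
  linarith

/-- Centered indicator of the `β`-neighborhood. -/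
def sgn (c : V → V → Bool) (β : Bool) (p : ℝ) (x i : V) : ℝ := (if c x i = β then 1 else 0) - p

lemma dens_ge {V : Type*} [DecidableEq V] (c : V → V → Bool) (β : Bool) (X X' Y : Finset V)
    (p α lam : ℝ) (hα : 0 < α) (hp : 0 ≤ p) (hY : Y.Nonempty)
    (hreg : ∀ v ∈ X, ((Y.filter fun y => c v y = β).card : ℝ) = p * Y.card)
    (hX' : X' ⊆ X) (hne : X'.Nonempty) (v : V) (hv : v ∈ X)
    (h : ∀ x ∈ X', lam ≤ (α * (p * Y.card))⁻¹ * ∑ i ∈ Y, sgn c β p v i * sgn c β p x i) :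
    p + lam * α ≤ (((X' ×ˢ (Y.filter fun y => c v y = β)).filter
      fun q => c q.1 q.2 = β).card : ℝ) /
      ((X'.card : ℝ) * ((Y.filter fun y => c v y = β).card : ℝ)) := by
  have hYc : (0 : ℝ) < Y.card := by exact_mod_cast hY.card_pos
  have hXc : (0 : ℝ) < X'.card := by exact_mod_cast hne.card_pos
  rw [hreg v hv]
  rcases hp.eq_or_lt with h0 | h0
  · obtain ⟨x, hx⟩ := hne
    have := h x hx
    rw [← h0] at this ⊢
    simp at this ⊢
    nlinarith
  · have hD : 0 < p * Y.card := by positivity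
    have hsum : ((((X' ×ˢ (Y.filter fun y => c v y = β)).filter
        fun q => c q.1 q.2 = β).card : ℕ) : ℝ) =
        ∑ x ∈ X', (((Y.filter fun y => c v y = β).filter fun y => c x y = β).card : ℝ) := by
      rw [Finset.card_filter, Finset.sum_product]
      push_cast
      refine Finset.sum_congr rfl fun x _ => ?_
      rw [Finset.card_filter]
      push_cast
      rfl
    have hcnt : ∀ x ∈ X', (p + lam * α) * (p * Y.card) ≤
        (((Y.filter fun y => c v y = β).filter fun y => c x y = β).card : ℝ) := by
      intro x hx
      have h1 := h x hx
      have hs : ∑ i ∈ Y, sgn c β p v i * sgn c β p x i =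
          (((Y.filter fun y => c v y = β).filter fun y => c x y = β).card : ℝ)
            - p * (p * Y.card) := by
        have e1 := hreg v hv
        have e2 := hreg x (hX' hx)
        rw [Finset.card_filter] at e1 e2
        push_cast at e1 e2
        have : ∀ i ∈ Y, sgn c β p v i * sgn c β p x i =
            (if c v i = β ∧ c x i = β then (1 : ℝ) else 0)
            - p * (if c v i = β then (1 : ℝ) else 0)
            - p * (if c x i = β then (1 : ℝ) else 0) + p * p := by
          intro i _
          unfold sgn
          by_cases hh1 : c v i = β <;> by_cases hh2 : c x i = β <;> simp [hh1, hh2] <;> ring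
        rw [Finset.sum_congr rfl this, Finset.sum_add_distrib, Finset.sum_sub_distrib,
          Finset.sum_sub_distrib, ← Finset.mul_sum, ← Finset.mul_sum, e1, e2,
          Finset.filter_filter, Finset.card_filter]
        push_cast
        rw [Finset.sum_const, nsmul_eq_mul]
        ring
      rw [hs, inv_mul_eq_div, le_div_iff₀ (by positivity)] at h1
      linarith
    rw [hsum, le_div_iff₀ (by positivity)]
    have := Finset.card_nsmul_le_sum X' _ _ hcnt
    rw [nsmul_eq_mul] at this
    linarith

/-- **Refinement lemma** (Balister–Bollobás–Campos–Griffiths–Hurley–Morris–Sahasrabudhe–Tiba).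
Given disjoint nonempty sets `X, Y, Z` in a two-colored complete graph, parameters
`α_R, α_B ∈ (0,1)`, and assuming every vertex of `X` has exactly `p_R |Y|` red neighbors in
`Y` and exactly `p_B |Z|` blue neighbors in `Z` (where `p_R = d_R(X,Y)`, `p_B = d_B(X,Z)`),
there exist `v ∈ X`, `X' ⊆ X`, and `κ ≥ 0` such that, with `Y' = Y ∩ N_R(v)` and
`Z' = Z ∩ N_B(v)`: `|X'| ≥ (1/8)·2^(-6κ)·|X|`, there is no density drop in either color,
and there is a density boost of `(κ²-1)α` in one of the colors. -/
theorem refinement_lemma (c : V → V → Bool) (hsymm : ∀ v w, c v w = c w v)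
    (X Y Z : Finset V) (hXY : Disjoint X Y) (hXZ : Disjoint X Z) (hYZ : Disjoint Y Z)
    (hX : X.Nonempty) (hY : Y.Nonempty) (hZ : Z.Nonempty)
    (αR αB : ℝ) (hαR : αR ∈ Set.Ioo (0 : ℝ) 1) (hαB : αB ∈ Set.Ioo (0 : ℝ) 1)
    (hregR : ∀ v ∈ X,
      ((Y.filter fun y => c v y = true).card : ℝ) = redDensity c X Y * Y.card)
    (hregB : ∀ v ∈ X,
      ((Z.filter fun z => c v z = false).card : ℝ) = blueDensity c X Z * Z.card) :
    ∃ v ∈ X, ∃ X' ⊆ X, ∃ κ : ℝ, 0 ≤ κ ∧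
      ((1 / 8 : ℝ) * (2 : ℝ) ^ (-(6 * κ)) * X.card ≤ (X'.card : ℝ)) ∧
      (redDensity c X' (Y.filter fun y => c v y = true) ≥ redDensity c X Y - αR ∧
        blueDensity c X' (Z.filter fun z => c v z = false) ≥ blueDensity c X Z - αB) ∧
      (redDensity c X' (Y.filter fun y => c v y = true) ≥
          redDensity c X Y + (κ ^ 2 - 1) * αR ∨
        blueDensity c X' (Z.filter fun z => c v z = false) ≥
          blueDensity c X Z + (κ ^ 2 - 1) * αB) := by
  classical
  have hpR : 0 ≤ redDensity c X Y := by unfold redDensity; positivity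
  have hpB : 0 ≤ blueDensity c X Z := by unfold blueDensity; positivity
  have hXc : (0 : ℝ) < X.card := by exact_mod_cast hX.card_pos
  have hR := fun X' lam => dens_ge c true X X' Y (redDensity c X Y) αR lam hαR.1 hpR hY hregR
  have hB := fun X' lam => dens_ge c false X X' Z (blueDensity c X Z) αB lam hαB.1 hpB hZ hregB
  obtain ⟨v, hv, k, hk⟩ := core X Y Z hX (sgn c true (redDensity c X Y))
    (sgn c false (blueDensity c X Z)) (αR * (redDensity c X Y * Y.card))⁻¹
    (αB * (blueDensity c X Z * Z.card))⁻¹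
    (inv_nonneg.2 (mul_nonneg hαR.1.le (by positivity)))
    (inv_nonneg.2 (mul_nonneg hαB.1.le (by positivity)))
    _ _ (fun _ _ => rfl) (fun _ _ => rfl)
  have hpw : (2 : ℝ) ^ (-(6 * (k : ℝ))) = (64 ^ k)⁻¹ := by
    rw [Real.rpow_neg (by norm_num), Real.rpow_mul (by norm_num), Real.rpow_natCast]
    norm_num
  have hpos : (0 : ℝ) < (1 / 8 : ℝ) * (64 ^ k)⁻¹ * X.card := by positivity
  have hk1 : (-1 : ℝ) ≤ (k : ℝ) ^ 2 - 1 := by nlinarith [sq_nonneg (k : ℝ)]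
  rcases hk with hk | hk
  · have hne := Finset.card_pos.1 (Nat.cast_pos.1 (hpos.trans_le hk))
    have r1 := hR _ ((k : ℝ) ^ 2 - 1) (Finset.filter_subset _ _) hne v hv
      (fun x hx => (Finset.mem_filter.1 hx).2.1)
    have b1 := hB _ (-1) (Finset.filter_subset _ _) hne v hv
      (fun x hx => (Finset.mem_filter.1 hx).2.2)
    refine ⟨v, hv, _, Finset.filter_subset _ _, k, by positivity, by rw [hpw]; exact hk,
      ⟨?_, ?_⟩, Or.inl r1⟩
    · refine le_trans ?_ r1
      nlinarith [hαR.1]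
    · refine le_trans ?_ b1
      linarith
  · have hne := Finset.card_pos.1 (Nat.cast_pos.1 (hpos.trans_le hk))
    have r1 := hB _ ((k : ℝ) ^ 2 - 1) (Finset.filter_subset _ _) hne v hv
      (fun x hx => (Finset.mem_filter.1 hx).2.1)
    have b1 := hR _ (-1) (Finset.filter_subset _ _) hne v hv
      (fun x hx => (Finset.mem_filter.1 hx).2.2)
    refine ⟨v, hv, _, Finset.filter_subset _ _, k, by positivity, by rw [hpw]; exact hk,
      ⟨?_, ?_⟩, Or.inr r1⟩
    · refine le_trans ?_ b1
      linarith
    · refine le_trans ?_ r1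
      nlinarith [hαB.1]
end

section
/- Let X, Y, Z be disjoint nonempty sets of vertices in a two-colored complete graph and let α_R, α_B ∈ (0,1). Set p_R = d_R(X,Y) and p_B = d_B(X,Z), and assume every vertex of X has exactly p_R·|Y| red neighbors in Y and exactly p_B·|Z| blue neighbors in Z. For v ∈ X write N_Y(v) = Y ∩ N_R(v) and N_Z(v) = Z ∩ N_B(v). Then there exists a real number κ ≥ 0 such that the number of ordered pairs (v,w) ∈ X × X with |N_Y(v) ∩ N_Y(w)| ≥ (p_R + (κ²-1)α_R)·p_R·|Y| and |N_Z(v) ∩ N_Z(w)| ≥ (p_B - α_B)·p_B·|Z| is at least (1/8)·2^{-6κ}·|X|², or else the same holds upon swapping the roles of red with blue and Y with Z (i.e., the number of pairs (v,w) with |N_Z(v) ∩ N_Z(w)| ≥ (p_B + (κ²-1)α_B)·p_B·|Z| and |N_Y(v) ∩ N_Y(w)| ≥ (p_R - α_R)·p_R·|Y| is at least (1/8)·2^{-6κ}·|X|²). -/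
open Finset

variable {V : Type*} [DecidableEq V]

theorem prl_moment {V : Type*} (X Y Z : Finset V) (s t : V → V → ℝ) (lam mu : ℝ)
    (hl : 0 ≤ lam) (hm : 0 ≤ mu) (k l : ℕ) :
    0 ≤ ∑ p ∈ X ×ˢ X, (lam * ∑ y ∈ Y, s p.1 y * s p.2 y) ^ k *
      (mu * ∑ z ∈ Z, t p.1 z * t p.2 z) ^ l := by
  have step : ∀ (K : V × V → ℝ) (W : Finset V) (u : V → V → ℝ) (nu : ℝ), 0 ≤ nu →
      (∀ g : V → ℝ, 0 ≤ ∑ p ∈ X ×ˢ X, g p.1 * g p.2 * K p) →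
      ∀ g : V → ℝ, 0 ≤ ∑ p ∈ X ×ˢ X, g p.1 * g p.2 *
        (K p * (nu * ∑ y ∈ W, u p.1 y * u p.2 y)) := by
    intro K W u nu hnu hK g
    have : ∑ p ∈ X ×ˢ X, g p.1 * g p.2 * (K p * (nu * ∑ y ∈ W, u p.1 y * u p.2 y)) =
        nu * ∑ y ∈ W, ∑ p ∈ X ×ˢ X, (g p.1 * u p.1 y) * (g p.2 * u p.2 y) * K p := by
      rw [Finset.sum_comm, Finset.mul_sum]
      refine Finset.sum_congr rfl fun p _ => ?_
      simp only [Finset.mul_sum]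
      refine Finset.sum_congr rfl fun y _ => ?_
      ring
    rw [this]
    exact mul_nonneg hnu (Finset.sum_nonneg fun y _ => hK fun v => g v * u v y)
  have main : ∀ g : V → ℝ, 0 ≤ ∑ p ∈ X ×ˢ X, g p.1 * g p.2 *
      ((lam * ∑ y ∈ Y, s p.1 y * s p.2 y) ^ k * (mu * ∑ z ∈ Z, t p.1 z * t p.2 z) ^ l) := by
    induction l with
    | zero =>
      induction k with
      | zero =>
        intro g
        simp only [pow_zero, mul_one]
        rw [Finset.sum_product, ← Finset.sum_mul_sum]
        exact mul_self_nonneg _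
      | succ k ih =>
        intro g
        have := step _ Y s lam hl ih g
        simpa only [pow_zero, mul_one, pow_succ] using this
    | succ l ih =>
      intro g
      have := step _ Z t mu hm ih g
      simpa only [pow_succ, mul_assoc] using this
  simpa using main fun _ => 1

/-- The entire function `cosh (2 √x)`. -/
noncomputable def prlG (x : ℝ) : ℝ :=
  if 0 ≤ x then Real.cosh (2 * √x) else Real.cos (2 * √(-x))

theorem prlG_hasSum (x : ℝ) :
    HasSum (fun n : ℕ => (4 ^ n / ((2 * n).factorial : ℝ)) * x ^ n) (prlG x) := by
  unfold prlG
  split_ifs with h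
  · convert Real.hasSum_cosh (2 * √x) using 2 with n
    rw [pow_mul, mul_pow, Real.sq_sqrt h, mul_pow]; norm_num; ring
  · convert Real.hasSum_cos (2 * √(-x)) using 2 with n
    rw [pow_mul, mul_pow, Real.sq_sqrt (by linarith), mul_pow, neg_pow x]
    have : ((-1 : ℝ) ^ n) * (-1) ^ n = 1 := by rw [← mul_pow]; norm_num
    norm_num
    linear_combination (-(4 ^ n * x ^ n / ((2 * n).factorial : ℝ))) * this

theorem prlG_sum {ι : Type*} (P : Finset ι) (a b : ι → ℝ)
    (h : ∀ k l : ℕ, 0 ≤ ∑ p ∈ P, a p ^ k * b p ^ l) :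
    0 ≤ ∑ p ∈ P, a p * (2 + prlG (b p)) := by
  have h1 : 0 ≤ ∑ p ∈ P, a p * prlG (b p) := by
    have hs : HasSum (fun n : ℕ => ∑ p ∈ P,
        a p * ((4 ^ n / ((2 * n).factorial : ℝ)) * b p ^ n)) (∑ p ∈ P, a p * prlG (b p)) :=
      hasSum_sum fun p _ => (prlG_hasSum (b p)).mul_left (a p)
    refine hs.nonneg fun n => ?_
    have h2 := mul_nonneg (show 0 ≤ (4 ^ n / ((2 * n).factorial : ℝ)) by positivity) (h 1 n)
    rw [Finset.mul_sum] at h2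
    refine h2.trans_eq (Finset.sum_congr rfl fun p _ => by ring)
  have h0 := h 1 0
  simp only [pow_one, pow_zero, mul_one] at h0
  simp only [mul_add, Finset.sum_add_distrib, ← Finset.sum_mul]
  linarith

theorem prlG_neg {x : ℝ} (h : x < 0) : -1 ≤ prlG x ∧ prlG x ≤ 1 := by
  unfold prlG
  rw [if_neg (by linarith)]
  exact ⟨Real.neg_one_le_cos _, Real.cos_le_one _⟩

theorem prlG_low {x : ℝ} (h : 0 ≤ x) : 1 + 2 * x + 2 / 3 * x ^ 2 ≤ prlG x := by
  have := sum_le_hasSum (Finset.range 3) (fun n _ => by positivity) (prlG_hasSum x)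
  refine le_trans (le_of_eq ?_) this
  simp [Finset.sum_range_succ, Nat.factorial]
  norm_num

theorem prlG_up {x : ℝ} (m : ℕ) (h : 0 ≤ x) (hm : x ≤ (m : ℝ) ^ 2 / 4) :
    prlG x ≤ ((11 / 4) ^ m + 1) / 2 := by
  unfold prlG
  rw [if_pos h, Real.cosh_eq]
  have h1 : 2 * √x ≤ m := by
    have : √x ≤ m / 2 := Real.sqrt_le_iff.2 ⟨by positivity, by linarith⟩
    linarith
  have h2 : Real.exp (2 * √x) ≤ (11 / 4) ^ m := by
    refine (Real.exp_le_exp.2 h1).trans ?_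
    rw [← Real.exp_one_pow]
    have := Real.exp_one_lt_d9
    gcongr
    linarith
  have h3 : Real.exp (-(2 * √x)) ≤ 1 := Real.exp_le_one_iff.2 (by simp)
  linarith

theorem prl_num (m : ℕ) (hm : 3 ≤ m) :
    ((m : ℝ) ^ 2 / 4 - 1) * 2 * (2 + ((11 / 4) ^ m + 1) / 2) ≤ 3 / 2 * 4 ^ m := by
  rcases Nat.lt_or_ge m 6 with h | h
  · interval_cases m <;> norm_num
  · induction m, h using Nat.le_induction with
    | base => norm_num
    | succ m hm' ih =>
      have ih := ih (by omega)
      have hm6 : (6 : ℝ) ≤ m := by exact_mod_cast hm'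
      have hE : (0 : ℝ) < (11 / 4) ^ m := by positivity
      push_cast
      rw [pow_succ (11 / 4 : ℝ), pow_succ (4 : ℝ)]
      generalize ((11 : ℝ) / 4) ^ m = E at *
      have h1 : ((m : ℝ) + 1) ^ 2 / 4 - 1 ≤ 16 / 11 * ((m : ℝ) ^ 2 / 4 - 1) := by nlinarith
      have h2 : (0 : ℝ) ≤ (m : ℝ) ^ 2 / 4 - 1 := by nlinarith
      have h3 : (2 + (E * (11 / 4) + 1) / 2) ≤ 11 / 4 * (2 + (E + 1) / 2) := by linarith
      have h4 := mul_le_mul h1 h3 (by positivity) (by positivity)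
      nlinarith

noncomputable def prlF (a b : ℝ) : ℝ := a * (2 + prlG b) + b * (2 + prlG a)

theorem prlF_comm (a b : ℝ) : prlF a b = prlF b a := by unfold prlF; ring

theorem prlF_out {a b : ℝ} (h : a < -1) : prlF a b ≤ -1 := by
  unfold prlF
  obtain ⟨g1, g2⟩ := prlG_neg (show a < 0 by linarith)
  rcases lt_or_ge b 0 with hb | hb
  · obtain ⟨g3, g4⟩ := prlG_neg hb
    nlinarith
  · have := prlG_low hb
    have h1 : a * (2 + prlG b) ≤ -(2 + prlG b) := by nlinarith [sq_nonneg b]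
    have h2 : b * (2 + prlG a) ≤ b * 3 := by gcongr; linarith
    nlinarith [sq_nonneg (b - 3 / 4)]

theorem prlF_out2 {a b : ℝ} (h : ¬ (-1 ≤ a ∧ -1 ≤ b)) : prlF a b ≤ -1 := by
  rcases not_and_or.1 h with h | h
  · exact prlF_out (not_le.1 h)
  · rw [prlF_comm]; exact prlF_out (not_le.1 h)

theorem prlF_nonpos {a b : ℝ} (ha : a < 0) (hb : b < 0) : prlF a b ≤ 0 := by
  unfold prlF
  have := (prlG_neg ha).1
  have := (prlG_neg hb).1
  nlinarith

theorem prlF_up {a b : ℝ} (m : ℕ) (hm : 3 ≤ m)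
    (ha' : a ≤ (m : ℝ) ^ 2 / 4 - 1) (hb' : b ≤ (m : ℝ) ^ 2 / 4 - 1) :
    prlF a b ≤ 3 / 2 * 4 ^ m := by
  refine le_trans ?_ (prl_num m hm)
  have hm3 : (3 : ℝ) ≤ m := by exact_mod_cast hm
  have hx : (0 : ℝ) ≤ (m : ℝ) ^ 2 / 4 - 1 := by nlinarith
  have key : ∀ a b : ℝ, a ≤ (m : ℝ) ^ 2 / 4 - 1 → b ≤ (m : ℝ) ^ 2 / 4 - 1 →
      a * (2 + prlG b) ≤ ((m : ℝ) ^ 2 / 4 - 1) * (2 + ((11 / 4) ^ m + 1) / 2) := by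
    intro a b ha hb
    have h1 : prlG b ≤ ((11 / 4) ^ m + 1) / 2 ∧ 0 ≤ 2 + prlG b := by
      rcases lt_or_ge b 0 with h | h
      · have h1 : (1 : ℝ) ≤ (11 / 4) ^ m := one_le_pow₀ (by norm_num)
        have := prlG_neg h
        constructor <;> linarith
      · refine ⟨prlG_up m h (by linarith), ?_⟩
        have := prlG_low h
        nlinarith [sq_nonneg b]
    exact mul_le_mul ha (by linarith) h1.2 hx
  have h1 := key a b ha' hb'
  have h2 := key b a hb' ha'
  unfold prlF
  linarith

theorem prl_abstract {ι : Type*} (P : Finset ι) (hP : P.Nonempty) (a b : ι → ℝ)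
    (h : ∀ k l : ℕ, 0 ≤ ∑ p ∈ P, a p ^ k * b p ^ l) :
    ∃ k : ℕ, (1 / 8 : ℝ) * (1 / 8) ^ k * P.card ≤
        ((P.filter fun p => (k : ℝ) ^ 2 / 4 - 1 ≤ a p ∧ -1 ≤ b p).card : ℝ) ∨
      (1 / 8 : ℝ) * (1 / 8) ^ k * P.card ≤
        ((P.filter fun p => (k : ℝ) ^ 2 / 4 - 1 ≤ b p ∧ -1 ≤ a p).card : ℝ) := by
  by_contra! hcon
  have hn : (0 : ℝ) < P.card := by exact_mod_cast hP.card_pos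
  have hF : 0 ≤ ∑ p ∈ P, prlF (a p) (b p) := by
    unfold prlF
    rw [Finset.sum_add_distrib]
    refine add_nonneg (prlG_sum P a b h) (prlG_sum P b a fun k l => ?_)
    refine (h l k).trans_eq (Finset.sum_congr rfl fun p _ => by ring)
  -- a uniform bound
  obtain ⟨N, hN⟩ : ∃ N : ℕ, ∀ p ∈ P, a p < (N : ℝ) ^ 2 / 4 - 1 ∧ b p < (N : ℝ) ^ 2 / 4 - 1 := by
    obtain ⟨N, hN⟩ := exists_nat_gt (∑ p ∈ P, (|a p| + |b p|))
    refine ⟨N + 4, fun p hp => ?_⟩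
    have h1 : |a p| + |b p| ≤ ∑ p ∈ P, (|a p| + |b p|) :=
      Finset.single_le_sum (f := fun p => |a p| + |b p|) (fun _ _ => by positivity) hp
    have h2 := le_abs_self (a p)
    have h3 := le_abs_self (b p)
    have h4 := abs_nonneg (a p)
    have h5 := abs_nonneg (b p)
    push_cast
    have h6 : (0 : ℝ) ≤ N := by positivity
    constructor <;> nlinarith
  let iA : ℕ → ι → ℝ := fun j p => if (j : ℝ) ^ 2 / 4 - 1 ≤ a p ∧ -1 ≤ b p then 1 else 0
  let iB : ℕ → ι → ℝ := fun j p => if (j : ℝ) ^ 2 / 4 - 1 ≤ b p ∧ -1 ≤ a p then 1 else 0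
  have iA0 : ∀ j p, 0 ≤ iA j p := fun j p => by dsimp only [iA]; split_ifs <;> norm_num
  have iB0 : ∀ j p, 0 ≤ iB j p := fun j p => by dsimp only [iB]; split_ifs <;> norm_num
  have hpt : ∀ p ∈ P, prlF (a p) (b p) ≤ (iA 0 p - 1) +
      ∑ j ∈ Finset.Ico 2 N, 6 * 4 ^ j * (iA j p + iB j p) := by
    intro p hp
    have hS : 0 ≤ ∑ j ∈ Finset.Ico 2 N, 6 * 4 ^ j * (iA j p + iB j p) :=
      Finset.sum_nonneg fun j _ => mul_nonneg (by positivity) (add_nonneg (iA0 j p) (iB0 j p))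
    by_cases hE : -1 ≤ a p ∧ -1 ≤ b p
    · have h0 : iA 0 p = 1 := by
        dsimp only [iA]; rw [if_pos]; simpa using hE
      rw [h0]
      by_cases hneg : a p < 0 ∧ b p < 0
      · have := prlF_nonpos hneg.1 hneg.2
        linarith
      · have hex : ∃ m : ℕ, a p < (m : ℝ) ^ 2 / 4 - 1 ∧ b p < (m : ℝ) ^ 2 / 4 - 1 := ⟨N, hN p hp⟩
        classical
        have hs := Nat.find_spec hex
        have hle : Nat.find hex ≤ N := Nat.find_min' hex (hN p hp)
        have hmin := fun k => @Nat.find_min _ _ hex k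
        generalize Nat.find hex = m at hs hle hmin
        have hm3 : 3 ≤ m := by
          by_contra hlt
          apply hneg
          have : (m : ℝ) ≤ 2 := by exact_mod_cast (show m ≤ 2 by omega)
          have h0 : (0 : ℝ) ≤ m := by positivity
          constructor <;> nlinarith
        obtain ⟨k, rfl⟩ : ∃ k, m = k + 1 := ⟨m - 1, by omega⟩
        have hk := hmin k (by omega)
        have hi : 1 ≤ iA k p + iB k p := by
          rcases not_and_or.1 hk with hk | hk
          · have : iA k p = 1 := if_pos ⟨not_lt.1 hk, hE.2⟩
            have := iB0 k p
            linarith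
          · have : iB k p = 1 := if_pos ⟨not_lt.1 hk, hE.1⟩
            have := iA0 k p
            linarith
        have h1 := prlF_up (k + 1) hm3 hs.1.le hs.2.le
        have h2 := Finset.single_le_sum (f := fun j => 6 * 4 ^ j * (iA j p + iB j p))
          (fun j _ => mul_nonneg (by positivity) (add_nonneg (iA0 j p) (iB0 j p)))
          (Finset.mem_Ico.2 ⟨by omega, by omega⟩ : k ∈ Finset.Ico 2 N)
        have h3 : (6 : ℝ) * 4 ^ k * 1 ≤ 6 * 4 ^ k * (iA k p + iB k p) := by gcongr
        rw [pow_succ] at h1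
        linarith
    · have h0 : iA 0 p = 0 := by
        dsimp only [iA]; rw [if_neg]; simpa using hE
      have := prlF_out2 hE
      linarith
  have hAs : ∀ j, ∑ p ∈ P, iA j p < (1 / 8 : ℝ) * (1 / 8) ^ j * P.card := fun j => by
    have := (hcon j).1
    simpa only [iA, Finset.sum_boole] using this
  have hBs : ∀ j, ∑ p ∈ P, iB j p < (1 / 8 : ℝ) * (1 / 8) ^ j * P.card := fun j => by
    have := (hcon j).2
    simpa only [iB, Finset.sum_boole] using this
  have hsum := hF.trans (Finset.sum_le_sum hpt)
  rw [Finset.sum_add_distrib, Finset.sum_comm, Finset.sum_sub_distrib] at hsum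
  have hA0 := hAs 0
  have hb : ∑ j ∈ Finset.Ico 2 N, ∑ p ∈ P, 6 * 4 ^ j * (iA j p + iB j p) ≤
      ∑ j ∈ Finset.Ico 2 N, (3 / 2 * P.card) * (1 / 2 : ℝ) ^ j := by
    refine Finset.sum_le_sum fun j _ => ?_
    rw [← Finset.mul_sum, Finset.sum_add_distrib]
    have h1 : (∑ p ∈ P, iA j p + ∑ p ∈ P, iB j p) ≤ 1 / 4 * (1 / 8) ^ j * P.card := by
      linarith [hAs j, hBs j]
    refine (mul_le_mul_of_nonneg_left h1 (by positivity)).trans_eq ?_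
    have : (1 / 2 : ℝ) ^ j = 4 ^ j * (1 / 8) ^ j := by rw [← mul_pow]; norm_num
    rw [this]; ring
  rw [← Finset.mul_sum] at hb
  have hg : ∀ N : ℕ, ∑ j ∈ Finset.Ico 2 N, (1 / 2 : ℝ) ^ j ≤ 1 / 2 := by
    intro N
    have hs : Summable fun j : ℕ => (1 / 2 : ℝ) ^ (2 + j) := by
      simp only [pow_add]
      exact (summable_geometric_two).mul_left _
    rw [Finset.sum_Ico_eq_sum_range]
    refine (hs.sum_le_tsum _ fun _ _ => by positivity).trans ?_
    simp only [pow_add]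
    rw [tsum_mul_left, tsum_geometric_two]
    norm_num
  have hg' := mul_le_mul_of_nonneg_left (hg N) (show (0 : ℝ) ≤ 3 / 2 * P.card by positivity)
  simp only [Finset.sum_const, nsmul_eq_mul, mul_one, pow_zero] at hsum hA0
  linarith

theorem prl_inner {V : Type*} [DecidableEq V] (c : V → V → Bool) (β : Bool) (Y : Finset V)
    (p : ℝ) (v w : V)
    (hv : ((Y.filter fun y => c v y = β).card : ℝ) = p * Y.card)
    (hw : ((Y.filter fun y => c w y = β).card : ℝ) = p * Y.card) :
    ∑ y ∈ Y, ((if c v y = β then (1 : ℝ) else 0) - p) * ((if c w y = β then (1 : ℝ) else 0) - p) =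
      (((Y.filter fun y => c v y = β) ∩ (Y.filter fun y => c w y = β)).card : ℝ)
        - p ^ 2 * Y.card := by
  have h1 : ∀ y, ((if c v y = β then (1 : ℝ) else 0) - p) *
      ((if c w y = β then (1 : ℝ) else 0) - p) =
      (if c v y = β ∧ c w y = β then (1 : ℝ) else 0) - p * (if c v y = β then (1 : ℝ) else 0)
        - p * (if c w y = β then (1 : ℝ) else 0) + p ^ 2 := by
    intro y
    by_cases h1 : c v y = β <;> by_cases h2 : c w y = β <;> simp [h1, h2] <;> ring
  simp only [h1, Finset.sum_add_distrib, Finset.sum_sub_distrib, ← Finset.mul_sum,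
    Finset.sum_boole, Finset.sum_const, nsmul_eq_mul]
  rw [hv, hw, ← Finset.filter_and]
  ring

theorem prl_impl {p α n S C t : ℝ} (hp : 0 ≤ p) (hα : 0 < α) (hn : 0 < n)
    (hC : 0 ≤ C) (hS : S = C - p ^ 2 * n) (h : t ≤ (α * p * n)⁻¹ * S) :
    (p + t * α) * p * n ≤ C := by
  rcases hp.eq_or_lt with rfl | hp
  · simpa using hC
  · rw [inv_mul_eq_div, le_div_iff₀ (by positivity)] at h
    subst hS
    linarith

/-- **Probabilistic refinement lemma.** Under the same hypotheses as the refinement lemma,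
there is `κ ≥ 0` such that for at least a `(1/8)·2^(-6κ)` fraction of the ordered pairs
`(v,w) ∈ X × X`, the common red neighborhood in `Y` is boosted and the common blue
neighborhood in `Z` does not drop — or the same holds with the colors (and `Y`, `Z`)
swapped. -/
theorem probabilistic_refinement_lemma (c : V → V → Bool) (hsymm : ∀ v w, c v w = c w v)
    (X Y Z : Finset V) (hXY : Disjoint X Y) (hXZ : Disjoint X Z) (hYZ : Disjoint Y Z)
    (hX : X.Nonempty) (hY : Y.Nonempty) (hZ : Z.Nonempty)
    (αR αB : ℝ) (hαR : αR ∈ Set.Ioo (0 : ℝ) 1) (hαB : αB ∈ Set.Ioo (0 : ℝ) 1)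
    (hregR : ∀ v ∈ X,
      ((Y.filter fun y => c v y = true).card : ℝ) = redDensity c X Y * Y.card)
    (hregB : ∀ v ∈ X,
      ((Z.filter fun z => c v z = false).card : ℝ) = blueDensity c X Z * Z.card) :
    ∃ κ : ℝ, 0 ≤ κ ∧
      ((1 / 8 : ℝ) * (2 : ℝ) ^ (-(6 * κ)) * (X.card : ℝ) ^ 2 ≤
        ({p : V × V | p.1 ∈ X ∧ p.2 ∈ X ∧
          (redDensity c X Y + (κ ^ 2 - 1) * αR) * redDensity c X Y * Y.card ≤
            (((Y.filter fun y => c p.1 y = true) ∩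
              (Y.filter fun y => c p.2 y = true)).card : ℝ) ∧
          (blueDensity c X Z - αB) * blueDensity c X Z * Z.card ≤
            (((Z.filter fun z => c p.1 z = false) ∩
              (Z.filter fun z => c p.2 z = false)).card : ℝ)}.ncard : ℝ) ∨
      (1 / 8 : ℝ) * (2 : ℝ) ^ (-(6 * κ)) * (X.card : ℝ) ^ 2 ≤
        ({p : V × V | p.1 ∈ X ∧ p.2 ∈ X ∧
          (blueDensity c X Z + (κ ^ 2 - 1) * αB) * blueDensity c X Z * Z.card ≤
            (((Z.filter fun z => c p.1 z = false) ∩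
              (Z.filter fun z => c p.2 z = false)).card : ℝ) ∧
          (redDensity c X Y - αR) * redDensity c X Y * Y.card ≤
            (((Y.filter fun y => c p.1 y = true) ∩
              (Y.filter fun y => c p.2 y = true)).card : ℝ)}.ncard : ℝ)) := by
  have hXc : (0 : ℝ) < X.card := by exact_mod_cast hX.card_pos
  have hYc : (0 : ℝ) < Y.card := by exact_mod_cast hY.card_pos
  have hZc : (0 : ℝ) < Z.card := by exact_mod_cast hZ.card_pos
  have hp : 0 ≤ redDensity c X Y := by unfold redDensity; positivity
  have hq : 0 ≤ blueDensity c X Z := by unfold blueDensity; positivity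
  generalize redDensity c X Y = p at *
  generalize blueDensity c X Z = q at *
  obtain ⟨hαR, -⟩ := hαR
  obtain ⟨hαB, -⟩ := hαB
  have hmom := prl_moment X Y Z (fun v y => (if c v y = true then (1 : ℝ) else 0) - p)
    (fun v z => (if c v z = false then (1 : ℝ) else 0) - q)
    (αR * p * Y.card)⁻¹ (αB * q * Z.card)⁻¹ (by positivity) (by positivity)
  obtain ⟨k, hk⟩ := prl_abstract (X ×ˢ X) (hX.product hX) _ _ hmom
  have hR : ∀ (v w : V) (t : ℝ), v ∈ X → w ∈ X → _ → _ := fun v w t hv hw h =>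
    prl_impl (t := t) hp hαR hYc (Nat.cast_nonneg _)
      (prl_inner c true Y p v w (hregR v hv) (hregR w hw)) h
  have hB : ∀ (v w : V) (t : ℝ), v ∈ X → w ∈ X → _ → _ := fun v w t hv hw h =>
    prl_impl (t := t) hq hαB hZc (Nat.cast_nonneg _)
      (prl_inner c false Z q v w (hregB v hv) (hregB w hw)) h
  have hpow : (2 : ℝ) ^ (-(6 * ((k : ℝ) / 2))) = (1 / 8) ^ k := by
    rw [show -(6 * ((k : ℝ) / 2)) = (-3 : ℝ) * k by ring, Real.rpow_mul (by norm_num),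
      Real.rpow_natCast]
    congr 1
    rw [Real.rpow_neg (by norm_num)]
    norm_num
  have hcard : ((X ×ˢ X).card : ℝ) = (X.card : ℝ) ^ 2 := by
    rw [Finset.card_product]; push_cast; ring
  have hsq : ((k : ℝ) / 2) ^ 2 - 1 = (k : ℝ) ^ 2 / 4 - 1 := by ring
  refine ⟨(k : ℝ) / 2, by positivity, ?_⟩
  rw [hpow, hsq, ← hcard]
  refine hk.imp (fun h => h.trans ?_) (fun h => h.trans ?_)
  · rw [← Set.ncard_coe_finset]
    refine Nat.cast_le.2 (Set.ncard_le_ncard ?_ ?_)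
    · rintro ⟨v, w⟩ hvw
      simp only [Finset.coe_filter, Finset.mem_product, Set.mem_setOf_eq] at hvw
      obtain ⟨⟨hv, hw⟩, h1, h2⟩ := hvw
      refine ⟨hv, hw, hR v w _ hv hw h1, ?_⟩
      have := hB v w _ hv hw h2
      simpa only [neg_one_mul, ← sub_eq_add_neg] using this
    · refine (X ×ˢ X).finite_toSet.subset fun x hx => ?_
      simp only [Finset.coe_product, Set.mem_prod, Finset.mem_coe]
      exact ⟨hx.1, hx.2.1⟩
  · rw [← Set.ncard_coe_finset]
    refine Nat.cast_le.2 (Set.ncard_le_ncard ?_ ?_)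
    · rintro ⟨v, w⟩ hvw
      simp only [Finset.coe_filter, Finset.mem_product, Set.mem_setOf_eq] at hvw
      obtain ⟨⟨hv, hw⟩, h1, h2⟩ := hvw
      refine ⟨hv, hw, hB v w _ hv hw h1, ?_⟩
      have := hR v w _ hv hw h2
      simpa only [neg_one_mul, ← sub_eq_add_neg] using this
    · refine (X ×ˢ X).finite_toSet.subset fun x hx => ?_
      simp only [Finset.coe_product, Set.mem_prod, Finset.mem_coe]
      exact ⟨hx.1, hx.2.1⟩
end

section
/- Let X be a finite nonempty set, let n, m be natural numbers, and let σ_Y : X → ℝⁿ and σ_Z : X → ℝ^m be arbitrary functions. Then there exists a real number κ ≥ 0 such that the number of ordered pairs (v,w) ∈ X × X with ⟨σ_Y(v), σ_Y(w)⟩ ≥ κ² - 1 and ⟨σ_Z(v), σ_Z(w)⟩ ≥ -1 is at least (1/8)·2^{-6κ}·|X|², or else the same holds upon swapping the roles of σ_Y and σ_Z (i.e., the number of pairs (v,w) with ⟨σ_Z(v), σ_Z(w)⟩ ≥ κ² - 1 and ⟨σ_Y(v), σ_Y(w)⟩ ≥ -1 is at least (1/8)·2^{-6κ}·|X|²). 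-/
open scoped RealInnerProductSpace

/-- `cosh √x`, extended to negative `x` as `cos √(-x)`. -/
noncomputable def gC (x : ℝ) : ℝ :=
  if 0 ≤ x then Real.cosh (Real.sqrt x) else Real.cos (Real.sqrt (-x))

lemma gC_hasSum (x : ℝ) : HasSum (fun k : ℕ => x ^ k / ((2 * k).factorial : ℝ)) (gC x) := by
  unfold gC
  split_ifs with h
  · have := Real.hasSum_cosh (Real.sqrt x)
    simpa only [pow_mul, Real.sq_sqrt h] using this
  · have := Real.hasSum_cos (Real.sqrt (-x))
    have h' : 0 ≤ -x := by linarith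
    simpa only [pow_mul, Real.sq_sqrt h', ← mul_pow, neg_mul, one_mul, neg_neg,
      mul_neg] using this

lemma gC_ge (x : ℝ) : -1 ≤ gC x := by
  unfold gC
  split_ifs with h
  · linarith [Real.one_le_cosh (Real.sqrt x)]
  · exact Real.neg_one_le_cos _

lemma gC_le_one {x : ℝ} (hx : x < 0) : gC x ≤ 1 := by
  unfold gC
  rw [if_neg (by linarith)]
  exact Real.cos_le_one _

lemma gC_le_cosh {x t : ℝ} (ht : 0 ≤ t) (hx : x ≤ t ^ 2) : gC x ≤ Real.cosh t := by
  by_cases h : 0 ≤ x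
  · unfold gC
    rw [if_pos h, Real.cosh_le_cosh, abs_of_nonneg (Real.sqrt_nonneg _), abs_of_nonneg ht]
    exact Real.sqrt_le_iff.2 ⟨ht, hx⟩
  · exact (gC_le_one (by linarith)).trans (Real.one_le_cosh t)

lemma gC_lower {x : ℝ} (hx : 0 ≤ x) : 1 + x / 2 + x ^ 2 / 24 ≤ gC x := by
  have := sum_le_hasSum (Finset.range 3) (fun k _ => by positivity) (gC_hasSum x)
  simp [Finset.sum_range_succ, Nat.factorial] at this
  linarith

/-- The test function. -/
noncomputable def gF (x y : ℝ) : ℝ := x * (2 + gC (3 * y)) + y * (2 + gC (3 * x))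

lemma gF_comm (x y : ℝ) : gF x y = gF y x := by unfold gF; ring

lemma gF_bad {x : ℝ} (y : ℝ) (hx : x < -1) : gF x y ≤ -1 := by
  unfold gF
  have h1 := gC_ge (3 * x)
  have h2 := gC_ge (3 * y)
  have h3 : gC (3 * x) ≤ 1 := gC_le_one (by linarith)
  rcases le_or_gt y 0 with hy | hy
  · nlinarith
  · have h4 := gC_lower (x := 3 * y) (by linarith)
    have h5 : x * (2 + gC (3 * y)) ≤ -1 * (2 + gC (3 * y)) :=
      mul_le_mul_of_nonneg_right hx.le (by linarith)
    have h6 : y * (2 + gC (3 * x)) ≤ y * 3 := mul_le_mul_of_nonneg_left (by linarith) hy.le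
    nlinarith [sq_nonneg (y - 2)]

lemma gF_neg {x y : ℝ} (hx : x ≤ 0) (hy : y ≤ 0) : gF x y ≤ 0 := by
  unfold gF
  have h1 := gC_ge (3 * x)
  have h2 := gC_ge (3 * y)
  nlinarith

lemma exp_bound : Real.exp (7 / 4) ≤ 6 := by
  have h : Real.exp (7 / 4) ^ 4 ≤ 6 ^ 4 := by
    rw [← Real.exp_nat_mul]
    have : ((4 : ℕ) : ℝ) * (7 / 4) = ((7 : ℕ) : ℝ) * 1 := by norm_num
    rw [this, Real.exp_nat_mul]
    calc Real.exp 1 ^ 7 ≤ 2.7182818286 ^ 7 :=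
          pow_le_pow_left₀ (Real.exp_pos _).le Real.exp_one_lt_d9.le 7
      _ ≤ 6 ^ 4 := by norm_num
  exact le_of_pow_le_pow_left₀ (by norm_num) (by norm_num) h

lemma cosh_bound (k : ℕ) : Real.cosh (7 / 4 * ((k : ℝ) + 2)) ≤ (6 ^ (k + 2) + 1) / 2 := by
  rw [Real.cosh_eq]
  have h1 : Real.exp (7 / 4 * ((k : ℝ) + 2)) ≤ 6 ^ (k + 2) := by
    have : 7 / 4 * ((k : ℝ) + 2) = ((k + 2 : ℕ) : ℝ) * (7 / 4) := by push_cast; ring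
    rw [this, Real.exp_nat_mul]
    exact pow_le_pow_left₀ (Real.exp_pos _).le exp_bound _
  have h2 : Real.exp (-(7 / 4 * ((k : ℝ) + 2))) ≤ 1 := by
    rw [Real.exp_le_one_iff]
    have : (0 : ℝ) ≤ k := Nat.cast_nonneg k
    linarith
  linarith

lemma quad_bound (k : ℕ) : ((k : ℝ) + 2) ^ 2 - 1 ≤ 3 * (8 / 3) ^ k := by
  induction k with
  | zero => norm_num
  | succ k ih =>
    rw [pow_succ ((8 : ℝ) / 3) k]
    push_cast
    have : (0 : ℝ) ≤ k := Nat.cast_nonneg k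
    nlinarith

lemma gF_good {x y : ℝ} (k : ℕ)
    (hx' : x ≤ ((k : ℝ) + 2) ^ 2 - 1) (hy' : y ≤ ((k : ℝ) + 2) ^ 2 - 1) :
    gF x y ≤ 8 * 16 ^ (k + 1) := by
  have hk : (0 : ℝ) ≤ k := Nat.cast_nonneg k
  have key : ∀ u v : ℝ, u ≤ ((k : ℝ) + 2) ^ 2 - 1 → v ≤ ((k : ℝ) + 2) ^ 2 - 1 →
      u * (2 + gC (3 * v)) ≤ 4 * 16 ^ (k + 1) := by
    intro u v hu hv
    have h1 := gC_ge (3 * v)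
    have h2 : gC (3 * v) ≤ (6 ^ (k + 2) + 1) / 2 :=
      (gC_le_cosh (t := 7 / 4 * ((k : ℝ) + 2)) (by positivity) (by nlinarith)).trans
        (cosh_bound k)
    have h3 := hu.trans (quad_bound k)
    have h6 : (1 : ℝ) ≤ 6 ^ k := one_le_pow₀ (by norm_num)
    have h4 : 2 + gC (3 * v) ≤ 20.5 * 6 ^ k := by
      rw [pow_add] at h2
      linarith
    calc u * (2 + gC (3 * v)) ≤ (3 * (8 / 3) ^ k) * (2 + gC (3 * v)) :=
          mul_le_mul_of_nonneg_right h3 (by linarith)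
      _ ≤ (3 * (8 / 3) ^ k) * (20.5 * 6 ^ k) :=
          mul_le_mul_of_nonneg_left h4 (by positivity)
      _ = 61.5 * 16 ^ k := by
          have : (16 : ℝ) ^ k = (8 / 3) ^ k * 6 ^ k := by rw [← mul_pow]; norm_num
          rw [this]; ring
      _ ≤ 4 * 16 ^ (k + 1) := by
          rw [pow_succ]
          have : (0 : ℝ) ≤ 16 ^ k := by positivity
          linarith
  unfold gF
  linarith [key x y hx' hy', key y x hy' hx']

open Classical in
/-- Indicator that `x ≥ k² - 1` and `y ≥ -1`. -/
noncomputable def gA (k : ℕ) (x y : ℝ) : ℝ :=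
  if (k : ℝ) ^ 2 - 1 ≤ x ∧ -1 ≤ y then 1 else 0

lemma gA_nonneg (k : ℕ) (x y : ℝ) : 0 ≤ gA k x y := by
  unfold gA; split_ifs <;> norm_num

lemma gF_pointwise (x y : ℝ) (K : ℕ) (hxK : x + 1 ≤ K) (hyK : y + 1 ≤ K) :
    gF x y ≤ -1 + gA 0 x y +
      ∑ k ∈ Finset.range K, 8 * 16 ^ (k + 1) * (gA (k + 1) x y + gA (k + 1) y x) := by
  have hs : ∀ k ∈ Finset.range K,
      (0 : ℝ) ≤ 8 * 16 ^ (k + 1) * (gA (k + 1) x y + gA (k + 1) y x) := by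
    intro k _
    have := gA_nonneg (k + 1) x y
    have := gA_nonneg (k + 1) y x
    positivity
  have hs0 := Finset.sum_nonneg hs
  have h0 := gA_nonneg 0 x y
  by_cases hx : x < -1
  · linarith [gF_bad y hx]
  by_cases hy : y < -1
  · have := gF_bad x hy
    rw [gF_comm] at this
    linarith
  push Not at hx hy
  have hA0 : gA 0 x y = 1 := by
    unfold gA; rw [if_pos]; constructor <;> norm_num <;> linarith
  by_cases hn : x < 0 ∧ y < 0
  · linarith [gF_neg hn.1.le hn.2.le]
  have hM : 0 ≤ max x y := by
    by_contra h
    push Not at h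
    exact hn (max_lt_iff.1 h)
  set j := ⌊Real.sqrt (max x y + 1)⌋₊ with hj
  have hj1 : (j : ℝ) ≤ Real.sqrt (max x y + 1) := Nat.floor_le (Real.sqrt_nonneg _)
  have hj2 : Real.sqrt (max x y + 1) < j + 1 := Nat.lt_floor_add_one _
  have hsq := Real.sq_sqrt (show 0 ≤ max x y + 1 by linarith)
  have hsn := Real.sqrt_nonneg (max x y + 1)
  have hj0 : 1 ≤ j := by
    rw [hj, Nat.one_le_floor_iff]
    exact Real.one_le_sqrt.2 (by linarith)
  obtain ⟨k, hk⟩ : ∃ k, j = k + 1 := ⟨j - 1, by omega⟩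
  rw [hk] at hj1 hj2
  push_cast at hj1 hj2
  have hk0 : (0 : ℝ) ≤ k := Nat.cast_nonneg k
  have hlow : ((k : ℝ) + 1) ^ 2 - 1 ≤ max x y := by nlinarith
  have hup : max x y ≤ ((k : ℝ) + 2) ^ 2 - 1 := by nlinarith
  have hkK : k < K := by
    by_contra h
    push Not at h
    have h1 : (K : ℝ) ≤ k := by exact_mod_cast h
    have h2 : max x y + 1 ≤ K := by
      rcases max_choice x y with h | h <;> rw [h] <;> assumption
    nlinarith
  have hone : 1 ≤ gA (k + 1) x y + gA (k + 1) y x := by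
    rcases max_choice x y with h | h
    · have : gA (k + 1) x y = 1 := by
        unfold gA; rw [if_pos]; push_cast; rw [h] at hlow; exact ⟨hlow, hy⟩
      linarith [gA_nonneg (k + 1) y x]
    · have : gA (k + 1) y x = 1 := by
        unfold gA; rw [if_pos]; push_cast; rw [h] at hlow; exact ⟨hlow, hx⟩
      linarith [gA_nonneg (k + 1) x y]
  have hterm := Finset.single_le_sum hs (Finset.mem_range.2 hkK)
  have hF := gF_good k ((le_max_left x y).trans hup) ((le_max_right x y).trans hup)
  have : (8 : ℝ) * 16 ^ (k + 1) * 1 ≤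
      8 * 16 ^ (k + 1) * (gA (k + 1) x y + gA (k + 1) y x) :=
    mul_le_mul_of_nonneg_left hone (by positivity)
  linarith

lemma psd_pow {X : Type*} [Fintype X] {m : ℕ} (σ : X → EuclideanSpace ℝ (Fin m)) (b : ℕ) :
    ∀ c : X → ℝ, 0 ≤ ∑ v, ∑ w, c v * c w * ⟪σ v, σ w⟫ ^ b := by
  induction b with
  | zero =>
    intro c
    have : ∑ v, ∑ w, c v * c w * ⟪σ v, σ w⟫ ^ 0 = (∑ v, c v) * (∑ w, c w) := by
      simp [Finset.sum_mul_sum]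
    rw [this]
    exact mul_self_nonneg _
  | succ b ih =>
    intro c
    have : ∑ v, ∑ w, c v * c w * ⟪σ v, σ w⟫ ^ (b + 1) =
        ∑ i, ∑ v, ∑ w, (c v * σ v i) * (c w * σ w i) * ⟪σ v, σ w⟫ ^ b := by
      rw [Finset.sum_comm]
      simp_rw [Finset.sum_comm (s := (Finset.univ : Finset (Fin m)))]
      rw [Finset.sum_comm]
      refine Finset.sum_congr rfl fun v _ => ?_
      refine Finset.sum_congr rfl fun w _ => ?_
      have h : ⟪σ v, σ w⟫ = ∑ i, σ v i * σ w i := by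
        simp [PiLp.inner_apply, mul_comm]
      rw [pow_succ]
      nth_rewrite 2 [h]
      rw [Finset.mul_sum, Finset.mul_sum]
      refine Finset.sum_congr rfl fun i _ => ?_
      ring
    rw [this]
    exact Finset.sum_nonneg fun i _ => ih _

lemma psd_mul_pow {X : Type*} [Fintype X] {n m : ℕ} (τ : X → EuclideanSpace ℝ (Fin n))
    (σ : X → EuclideanSpace ℝ (Fin m)) (b : ℕ) :
    0 ≤ ∑ p : X × X, ⟪τ p.1, τ p.2⟫ * ⟪σ p.1, σ p.2⟫ ^ b := by
  have : ∑ p : X × X, ⟪τ p.1, τ p.2⟫ * ⟪σ p.1, σ p.2⟫ ^ b =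
      ∑ i, ∑ v, ∑ w, (τ v i) * (τ w i) * ⟪σ v, σ w⟫ ^ b := by
    rw [Fintype.sum_prod_type, Finset.sum_comm (s := (Finset.univ : Finset (Fin n)))]
    refine Finset.sum_congr rfl fun v _ => ?_
    rw [Finset.sum_comm (s := (Finset.univ : Finset (Fin n)))]
    refine Finset.sum_congr rfl fun w _ => ?_
    have h : ⟪τ v, τ w⟫ = ∑ i, τ v i * τ w i := by
      simp [PiLp.inner_apply, mul_comm]
    rw [h, Finset.sum_mul]
  rw [this]
  exact Finset.sum_nonneg fun i _ => psd_pow σ b _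

lemma psd_mul_gC {X : Type*} [Fintype X] {n m : ℕ} (τ : X → EuclideanSpace ℝ (Fin n))
    (σ : X → EuclideanSpace ℝ (Fin m)) :
    0 ≤ ∑ p : X × X, ⟪τ p.1, τ p.2⟫ * (2 + gC (3 * ⟪σ p.1, σ p.2⟫)) := by
  have h1 := psd_mul_pow τ σ 0
  have h2 : HasSum (fun k : ℕ => ∑ p : X × X,
      ⟪τ p.1, τ p.2⟫ * ((3 * ⟪σ p.1, σ p.2⟫) ^ k / ((2 * k).factorial : ℝ)))
      (∑ p : X × X, ⟪τ p.1, τ p.2⟫ * gC (3 * ⟪σ p.1, σ p.2⟫)) :=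
    hasSum_sum fun p _ => (gC_hasSum _).mul_left _
  have h3 : 0 ≤ ∑ p : X × X, ⟪τ p.1, τ p.2⟫ * gC (3 * ⟪σ p.1, σ p.2⟫) := by
    refine h2.nonneg fun k => ?_
    have : ∑ p : X × X,
        ⟪τ p.1, τ p.2⟫ * ((3 * ⟪σ p.1, σ p.2⟫) ^ k / ((2 * k).factorial : ℝ)) =
        3 ^ k / ((2 * k).factorial : ℝ) *
          ∑ p : X × X, ⟪τ p.1, τ p.2⟫ * ⟪σ p.1, σ p.2⟫ ^ k := by
      rw [Finset.mul_sum]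
      refine Finset.sum_congr rfl fun p _ => ?_
      rw [mul_pow]; ring
    rw [this]
    exact mul_nonneg (by positivity) (psd_mul_pow τ σ k)
  simp only [pow_zero, mul_one] at h1
  simp only [mul_add, Finset.sum_add_distrib, ← Finset.sum_mul]
  linarith

lemma sum_gA {X : Type*} [Fintype X] (x y : X × X → ℝ) (k : ℕ) :
    ∑ p, gA k (x p) (y p) =
      (Nat.card {p : X × X // (k : ℝ) ^ 2 - 1 ≤ x p ∧ (-1 : ℝ) ≤ y p} : ℝ) := by
  classical
  unfold gA
  rw [Nat.card_eq_fintype_card, Fintype.card_subtype, Finset.sum_boole]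

lemma geom_bound (K : ℕ) : ∑ k ∈ Finset.range K, ((1 : ℝ) / 4) ^ (k + 1) ≤ 1 / 3 := by
  have : ∑ k ∈ Finset.range K, ((1 : ℝ) / 4) ^ (k + 1) = 1 / 3 - 1 / 3 * (1 / 4) ^ K := by
    induction K with
    | zero => norm_num
    | succ K ih => rw [Finset.sum_range_succ, ih]; ring
  rw [this]
  have : (0 : ℝ) ≤ (1 / 4) ^ K := by positivity
  linarith

/-- **Geometric lemma** (Balister–Bollobás–Campos–Griffiths–Hurley–Morris–Sahasrabudhe–Tiba).
For arbitrary functions `σ_Y : X → ℝⁿ`, `σ_Z : X → ℝ^m` on a finite nonempty set `X`,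
there is `κ ≥ 0` such that for at least a `(1/8)·2^(-6κ)` fraction of the ordered pairs
`(v,w) ∈ X × X` one has `⟪σ_Y(v), σ_Y(w)⟫ ≥ κ² - 1` and `⟪σ_Z(v), σ_Z(w)⟫ ≥ -1`, or the
same holds with the roles of `σ_Y` and `σ_Z` swapped. -/
theorem geometric_lemma {X : Type*} [Fintype X] [Nonempty X] (n m : ℕ)
    (σY : X → EuclideanSpace ℝ (Fin n)) (σZ : X → EuclideanSpace ℝ (Fin m)) :
    ∃ κ : ℝ, 0 ≤ κ ∧
      ((1 / 8 : ℝ) * (2 : ℝ) ^ (-(6 * κ)) * (Fintype.card X : ℝ) ^ 2 ≤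
        (Nat.card {p : X × X //
          κ ^ 2 - 1 ≤ ⟪σY p.1, σY p.2⟫ ∧ (-1 : ℝ) ≤ ⟪σZ p.1, σZ p.2⟫} : ℝ) ∨
      (1 / 8 : ℝ) * (2 : ℝ) ^ (-(6 * κ)) * (Fintype.card X : ℝ) ^ 2 ≤
        (Nat.card {p : X × X //
          κ ^ 2 - 1 ≤ ⟪σZ p.1, σZ p.2⟫ ∧ (-1 : ℝ) ≤ ⟪σY p.1, σY p.2⟫} : ℝ)) := by
  by_contra hcon
  push Not at hcon
  set x : X × X → ℝ := fun p => ⟪σY p.1, σY p.2⟫ with hx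
  set y : X × X → ℝ := fun p => ⟪σZ p.1, σZ p.2⟫ with hy
  set N : ℝ := (Fintype.card X : ℝ) ^ 2 with hN
  have hNpos : 0 < N := by
    have : (0 : ℝ) < Fintype.card X := by exact_mod_cast Fintype.card_pos
    positivity
  have hpow : ∀ k : ℕ, (2 : ℝ) ^ (-(6 * (k : ℝ))) = (1 / 64) ^ k := by
    intro k
    rw [Real.rpow_neg (by norm_num), Real.rpow_mul (by norm_num), Real.rpow_natCast,
      one_div, inv_pow]
    norm_num
  have hA : ∀ k : ℕ, ∑ p, gA k (x p) (y p) ≤ 1 / 8 * (1 / 64) ^ k * N := by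
    intro k
    have := (hcon k (Nat.cast_nonneg k)).1
    rw [hpow] at this
    rw [sum_gA]
    exact this.le
  have hB : ∀ k : ℕ, ∑ p, gA k (y p) (x p) ≤ 1 / 8 * (1 / 64) ^ k * N := by
    intro k
    have := (hcon k (Nat.cast_nonneg k)).2
    rw [hpow] at this
    rw [sum_gA]
    exact this.le
  obtain ⟨K, hK⟩ := exists_nat_ge (∑ p, (|x p| + |y p|))
  have hle : ∀ p, |x p| + |y p| ≤ K := fun p =>
    (Finset.single_le_sum (f := fun p => |x p| + |y p|)
      (fun p _ => by positivity) (Finset.mem_univ p)).trans hK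
  have hF0 : 0 ≤ ∑ p, gF (x p) (y p) := by
    have h1 := psd_mul_gC σY σZ
    have h2 := psd_mul_gC σZ σY
    unfold gF
    rw [Finset.sum_add_distrib]
    exact add_nonneg h1 h2
  have hF1 : ∑ p, gF (x p) (y p) ≤ ∑ p, (-1 + gA 0 (x p) (y p) +
      ∑ k ∈ Finset.range (K + 1),
        8 * 16 ^ (k + 1) * (gA (k + 1) (x p) (y p) + gA (k + 1) (y p) (x p))) := by
    refine Finset.sum_le_sum fun p _ => gF_pointwise _ _ _ ?_ ?_
    · have := hle p
      have := le_abs_self (x p)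
      have := abs_nonneg (y p)
      push_cast; linarith
    · have := hle p
      have := le_abs_self (y p)
      have := abs_nonneg (x p)
      push_cast; linarith
  have hcard : ∑ _p : X × X, (-1 : ℝ) = -N := by
    simp [hN, Fintype.card_prod]; ring
  rw [Finset.sum_add_distrib, Finset.sum_add_distrib, hcard, Finset.sum_comm] at hF1
  have hF2 : ∑ k ∈ Finset.range (K + 1), ∑ p,
      8 * 16 ^ (k + 1) * (gA (k + 1) (x p) (y p) + gA (k + 1) (y p) (x p)) ≤
      ∑ k ∈ Finset.range (K + 1), 2 * N * (1 / 4) ^ (k + 1) := by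
    refine Finset.sum_le_sum fun k _ => ?_
    rw [← Finset.mul_sum, Finset.sum_add_distrib]
    have h1 := hA (k + 1)
    have h2 := hB (k + 1)
    calc _ ≤ (8 : ℝ) * 16 ^ (k + 1) * (1 / 4 * (1 / 64) ^ (k + 1) * N) :=
          mul_le_mul_of_nonneg_left (by linarith) (by positivity)
      _ = 2 * N * (1 / 4) ^ (k + 1) := by
          have : ((1 : ℝ) / 4) ^ (k + 1) = 16 ^ (k + 1) * (1 / 64) ^ (k + 1) := by
            rw [← mul_pow]; norm_num
          rw [this]; ring
  rw [← Finset.mul_sum] at hF2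
  have hg := geom_bound (K + 1)
  have h0 := hA 0
  norm_num at h0
  nlinarith
end
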